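/- arXiv:1106.5635 — 3 statements merged into one kernel-verified Lean document; each statement's English description precedes it below -/
import Mathlib

section
/- Let μ be an absolutely continuous rotation-invariant measure on ℝⁿ, let K be a convex body whose inscribed ball is the ball B of radius r centered at the origin, and let T be a plank (a slab {x : |⟨u, x⟩| ≤ r} for a unit vector u) whose inscribed ball is also B. Then μ(K) ≤ μ(T). -/
open MeasureTheory RealInnerProductSpace

section Contacts

variable {E : Type*} [NormedAddCommGroup E] [InnerProductSpace ℝ E] [FiniteDimensional ℝ E]

lemma isCompact_convexHull_aux {C : Set E} (hC : IsCompact C) :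
    IsCompact (convexHull ℝ C) := by
  classical
  rcases C.eq_empty_or_nonempty with rfl | ⟨c0, hc0⟩
  · simp
  let N := Module.finrank ℝ E + 1
  have hcomp : IsCompact ((stdSimplex ℝ (Fin N)) ×ˢ (Set.univ.pi fun _ : Fin N => C)) :=
    (isCompact_stdSimplex ℝ (Fin N)).prod (isCompact_univ_pi fun _ => hC)
  have hcont : Continuous fun p : (Fin N → ℝ) × (Fin N → E) => ∑ i, p.1 i • p.2 i := by
    fun_prop
  have := hcomp.image hcont
  convert this using 1
  ext x
  constructor
  · intro hx
    obtain ⟨ι, hι, z, w, hz, hai, hw, hw1, hx⟩ := eq_pos_convex_span_of_mem_convexHull hx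
    have hcard : Fintype.card ι ≤ Fintype.card (Fin N) := by
      rw [Fintype.card_fin]
      have := hai.card_le_finrank_succ
      refine this.trans ?_
      exact Nat.succ_le_succ (Submodule.finrank_le _)
    obtain ⟨f⟩ := Function.Embedding.nonempty_of_card_le hcard
    refine ⟨(Function.extend f w 0, Function.extend f z fun _ => c0), ⟨⟨?_, ?_⟩, ?_⟩, ?_⟩
    · intro j
      by_cases h : ∃ i, f i = j
      · obtain ⟨i, rfl⟩ := h
        simp only [f.injective.extend_apply]
        exact (hw i).le
      · simp [Function.extend_apply' _ _ _ h]
    · rw [← hw1]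
      symm
      refine Fintype.sum_of_injective f f.injective _ _ ?_ ?_
      · intro j hj
        exact Function.extend_apply' _ _ _ (by simpa using hj)
      · intro i
        simp only [f.injective.extend_apply]
    · intro j _
      by_cases h : ∃ i, f i = j
      · obtain ⟨i, rfl⟩ := h
        simp only [f.injective.extend_apply]
        exact hz ⟨i, rfl⟩
      · simpa [Function.extend_apply' _ _ _ h] using hc0
    · rw [← hx]
      symm
      refine Fintype.sum_of_injective f f.injective _ _ ?_ ?_
      · intro j hj
        simp [Function.extend_apply' w _ _ (show ¬ ∃ i, f i = j by simpa using hj)]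
      · intro i
        simp only [f.injective.extend_apply]
  · rintro ⟨⟨w, v⟩, ⟨⟨hw0, hw1⟩, hv⟩, rfl⟩
    exact (convex_convexHull ℝ C).sum_mem (fun i _ => hw0 i) hw1
      (fun i _ => subset_convexHull ℝ C (hv i (Set.mem_univ i)))

/-- Unit outer normals at the contact points. -/
lemma contacts {K : Set E} (hKconv : Convex ℝ K) (hKcomp : IsCompact K) {r : ℝ} (hr : 0 < r)
    (hball : Metric.closedBall 0 r ⊆ K)
    (hmax : ∀ (c : E) (R : ℝ), Metric.closedBall c R ⊆ K → R ≤ r) :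
    ∃ (S : Finset E) (w : E → ℝ), (∀ v ∈ S, 0 ≤ w v) ∧ ∑ v ∈ S, w v = 1 ∧
      ∑ v ∈ S, w v • v = 0 ∧ ∀ v ∈ S, ‖v‖ = 1 ∧ ∀ x ∈ K, ⟪v, x⟫ ≤ r := by
  classical
  let C : Set E := Metric.sphere 0 1 ∩ ⋂ x ∈ K, {v | ⟪v, x⟫ ≤ r}
  have hC : IsCompact C := by
    refine (isCompact_sphere _ _).inter_right ?_
    refine isClosed_biInter fun x _ => ?_
    exact isClosed_le (by fun_prop) (by fun_prop)
  suffices h0 : (0 : E) ∈ convexHull ℝ C by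
    rw [convexHull_eq_union_convexHull_finite_subsets] at h0
    simp only [Set.mem_iUnion] at h0
    obtain ⟨S, hS, h0⟩ := h0
    obtain ⟨w, hw, hw1, hw0⟩ := Finset.mem_convexHull'.1 h0
    refine ⟨S, w, hw, hw1, hw0, fun v hv => ?_⟩
    have := hS hv
    refine ⟨by simpa using this.1, fun x hx => ?_⟩
    simpa using Set.mem_iInter₂.1 this.2 x hx
  by_contra h0
  obtain ⟨f, c, hf0, hf⟩ := geometric_hahn_banach_point_closed (convex_convexHull ℝ C)
    (isCompact_convexHull_aux hC).isClosed h0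
  rw [map_zero] at hf0
  let w : E := -((InnerProductSpace.toDual ℝ E).symm f)
  have hw : ∀ v, ⟪v, w⟫ = - f v := by
    intro v
    simp only [w, inner_neg_right]
    rw [real_inner_comm, InnerProductSpace.toDual_symm_apply]
  have key : ∀ k : ℕ, ∃ v : E, ‖v‖ = 1 ∧ -(1 / ((k : ℝ) + 1)) ≤ ⟪v, w⟫ ∧
      ∀ x ∈ K, ⟪v, x⟫ ≤ r + (1 / ((k : ℝ) + 1)) * (‖w‖ + 1) := by
    intro k
    set e : ℝ := 1 / ((k : ℝ) + 1) with he
    have hepos : 0 < e := by positivity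
    have he1 : e ≤ 1 := by
      rw [he, div_le_one (by positivity)]; linarith [(Nat.cast_nonneg k : (0:ℝ) ≤ k)]
    have hn : ¬ Metric.closedBall (e • w) (r + e ^ 2) ⊆ K := by
      intro h
      have := hmax _ _ h
      nlinarith
    obtain ⟨y, hy, hyK⟩ := Set.not_subset.1 hn
    obtain ⟨g, d, hg, hgy⟩ := geometric_hahn_banach_closed_point hKconv hKcomp.isClosed hyK
    let q : E := (InnerProductSpace.toDual ℝ E).symm g
    have hq : ∀ x, ⟪q, x⟫ = g x := fun x => InnerProductSpace.toDual_symm_apply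
    have hq0 : 0 < ‖q‖ := by
      rw [norm_pos_iff]
      rintro hq0
      have h1 := hg 0 (hball (by simp [hr.le]))
      rw [← hq] at h1 hgy
      simp [hq0] at h1 hgy
      linarith
    set v : E := ‖q‖⁻¹ • q with hv
    have hv1 : ‖v‖ = 1 := by
      rw [hv, norm_smul, norm_inv, norm_norm, inv_mul_cancel₀ hq0.ne']
    have hle : ∀ x ∈ K, ⟪v, x⟫ ≤ ⟪v, y⟫ := by
      intro x hx
      simp only [hv, real_inner_smul_left, hq]
      have := hg x hx
      gcongr
      linarith
    have hyle : ⟪v, y⟫ ≤ e * ⟪v, w⟫ + (r + e ^ 2) := by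
      have h1 : ⟪v, y - e • w⟫ ≤ ‖v‖ * ‖y - e • w‖ := real_inner_le_norm _ _
      have h2 : ‖y - e • w‖ ≤ r + e ^ 2 := by
        simpa [dist_eq_norm] using hy
      rw [inner_sub_right, real_inner_smul_right, hv1, one_mul] at h1
      linarith
    have hrle : r ≤ ⟪v, y⟫ := by
      have := hle (r • v) (hball (by simp [norm_smul, hv1, abs_of_pos hr]))
      rwa [real_inner_smul_right, real_inner_self_eq_norm_sq, hv1, one_pow, mul_one] at this
    refine ⟨v, hv1, ?_, fun x hx => ?_⟩
    · have : 0 ≤ e * (⟪v, w⟫ + e) := by nlinarith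
      have := nonneg_of_mul_nonneg_right this hepos
      linarith
    · have h3 : ⟪v, w⟫ ≤ ‖w‖ := by
        have := real_inner_le_norm v w
        rwa [hv1, one_mul] at this
      have := hle x hx
      nlinarith
  choose v hv1 hvw hvK using key
  obtain ⟨v0, hv0, φ, hφ, hlim⟩ := (isCompact_sphere (0 : E) 1).tendsto_subseq
    (x := v) (fun k => by simp [hv1])
  have ht : Filter.Tendsto (fun k => 1 / (((φ k : ℕ) : ℝ) + 1)) Filter.atTop (nhds 0) :=
    tendsto_one_div_add_atTop_nhds_zero_nat.comp hφ.tendsto_atTop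
  have hvC : v0 ∈ C := by
    refine ⟨hv0, Set.mem_iInter₂.2 fun x hx => ?_⟩
    have h1 : Filter.Tendsto (fun k => ⟪v (φ k), x⟫) Filter.atTop (nhds ⟪v0, x⟫) :=
      hlim.inner tendsto_const_nhds
    have h2 := (ht.mul_const (‖w‖ + 1)).const_add r
    have := le_of_tendsto_of_tendsto' h1 h2 (fun k => hvK (φ k) x hx)
    simpa using this
  have h1 : Filter.Tendsto (fun k => ⟪v (φ k), w⟫) Filter.atTop (nhds ⟪v0, w⟫) :=
    hlim.inner tendsto_const_nhds
  have h2 := le_of_tendsto_of_tendsto' ht.neg h1 (fun k => hvw (φ k))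
  have h3 := hf v0 (subset_convexHull ℝ C hvC)
  rw [hw] at h2
  linarith

end Contacts

section Cyl

variable {F : Type*} [NormedAddCommGroup F] [InnerProductSpace ℝ F] [FiniteDimensional ℝ F]
  [MeasurableSpace F] [BorelSpace F]

/-- The weight on slopes. -/
noncomputable def slopeMeasure (m : ℕ) : Measure ℝ :=
  volume.withDensity fun b => ENNReal.ofReal ((√(1 + b ^ 2))⁻¹ ^ (m + 1))

lemma lintegral_scale (f : F → ENNReal) {c : ℝ} (hc : 0 < c) :
    ∫⁻ y, f y = ENNReal.ofReal (c ^ Module.finrank ℝ F) * ∫⁻ z, f (c • z) := by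
  have h1 : ∫⁻ z, f (c • z) = ∫⁻ y, f y ∂(Measure.map (fun x : F => c • x) volume) := by
    have := (Homeomorph.smulOfNeZero c hc.ne' : F ≃ₜ F).measurableEmbedding.lintegral_map
      (μ := volume) f
    exact this.symm
  rw [h1, Measure.map_addHaar_smul _ hc.ne', lintegral_smul_measure, smul_eq_mul, ← mul_assoc,
    ← ENNReal.ofReal_mul (by positivity), abs_of_pos (by positivity),
    mul_inv_cancel₀ (by positivity)]
  simp

lemma cone_formula [Nontrivial F] (D : Set (F × ℝ)) (hD : MeasurableSet D)
    (hcone : ∀ t : ℝ, 0 < t → ∀ p ∈ D, t • p ∈ D) :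
    ((volume : Measure F).prod (volume : Measure ℝ)) (D ∩ {p | ‖p.1‖ ^ 2 + p.2 ^ 2 < 1}) =
      ∫⁻ z : F, (ENNReal.ofReal ‖z‖ * (Metric.ball (0 : F) 1).indicator 1 z) *
        slopeMeasure (Module.finrank ℝ F) {b | (z, b * ‖z‖) ∈ D} := by
  classical
  set B : Set (F × ℝ) := {p | ‖p.1‖ ^ 2 + p.2 ^ 2 < 1} with hBdef
  have hB : MeasurableSet B := (isOpen_lt (by fun_prop) (by fun_prop)).measurableSet
  have hconeiff : ∀ t : ℝ, 0 < t → ∀ p, t • p ∈ D ↔ p ∈ D := by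
    intro t ht p
    refine ⟨fun h => ?_, hcone t ht p⟩
    have := hcone t⁻¹ (inv_pos.2 ht) _ h
    rwa [smul_smul, inv_mul_cancel₀ ht.ne', one_smul] at this
  have hmap : Measurable fun p : F × ℝ => (p.1, p.2 * ‖p.1‖) := by fun_prop
  have hDm : MeasurableSet {p : F × ℝ | (p.1, p.2 * ‖p.1‖) ∈ D} := hmap hD
  have hDBm : MeasurableSet {p : F × ℝ | (p.1, p.2 * ‖p.1‖) ∈ D ∩ B} := hmap (hD.inter hB)
  rw [Measure.prod_apply (hD.inter hB)]
  have step1 : ∀ᵐ y : F, volume (Prod.mk y ⁻¹' (D ∩ B)) =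
      ∫⁻ b : ℝ, ENNReal.ofReal ‖y‖ * {p : F × ℝ | (p.1, p.2 * ‖p.1‖) ∈ D ∩ B}.indicator 1 (y, b) := by
    have h0 : ∀ᵐ y : F, y ≠ 0 := by
      rw [ae_iff]; simp
    filter_upwards [h0] with y hy
    have hy' : 0 < ‖y‖ := norm_pos_iff.2 hy
    have h1 := Real.volume_preimage_mul_right hy'.ne' (Prod.mk y ⁻¹' (D ∩ B))
    have h2 : MeasurableSet ((fun x => x * ‖y‖) ⁻¹' (Prod.mk y ⁻¹' (D ∩ B))) :=
      (measurable_id.mul_const _) (measurable_prodMk_left (hD.inter hB))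
    rw [lintegral_const_mul']
    · have h3 : ∫⁻ b : ℝ, {p : F × ℝ | (p.1, p.2 * ‖p.1‖) ∈ D ∩ B}.indicator
          (1 : F × ℝ → ENNReal) (y, b) = volume ((fun x => x * ‖y‖) ⁻¹' (Prod.mk y ⁻¹' (D ∩ B))) := by
        rw [← lintegral_indicator_one h2]
        rfl
      rw [h3, h1, ← mul_assoc, ← ENNReal.ofReal_mul hy'.le, abs_of_pos (by positivity),
        mul_inv_cancel₀ hy'.ne']
      simp
    · simp
  rw [lintegral_congr_ae step1, lintegral_lintegral_swap]
  swap
  · refine Measurable.aemeasurable ?_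
    exact (by fun_prop : Measurable fun p : F × ℝ => ENNReal.ofReal ‖p.1‖).mul
      (measurable_one.indicator hDBm)
  have step2 : ∀ b : ℝ, ∫⁻ y : F, ENNReal.ofReal ‖y‖ *
        {p : F × ℝ | (p.1, p.2 * ‖p.1‖) ∈ D ∩ B}.indicator 1 (y, b) =
      ∫⁻ z : F, (ENNReal.ofReal ‖z‖ * (Metric.ball (0 : F) 1).indicator 1 z) *
        (ENNReal.ofReal ((√(1 + b ^ 2))⁻¹ ^ (Module.finrank ℝ F + 1)) *
          {p : F × ℝ | (p.1, p.2 * ‖p.1‖) ∈ D}.indicator 1 (z, b)) := by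
    intro b
    have hs : 0 < √(1 + b ^ 2) := by positivity
    have hs2 : √(1 + b ^ 2) ^ 2 = 1 + b ^ 2 := Real.sq_sqrt (by positivity)
    set c := (√(1 + b ^ 2))⁻¹ with hc
    have hcpos : 0 < c := by positivity
    have hc2 : c ^ 2 * (1 + b ^ 2) = 1 := by
      rw [hc, inv_pow, hs2]; exact inv_mul_cancel₀ (by positivity)
    rw [lintegral_scale _ hcpos, ← lintegral_const_mul']
    · refine lintegral_congr fun z => ?_
      have hmem : ((c • z, b * ‖c • z‖) ∈ D ∩ B) ↔ (z, b * ‖z‖) ∈ D ∧ z ∈ Metric.ball (0 : F) 1 := by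
        have e1 : (c • z, b * ‖c • z‖) = c • (z, b * ‖z‖) := by
          simp [norm_smul, abs_of_pos hcpos, Prod.smul_mk]; ring
        rw [Set.mem_inter_iff, e1, hconeiff c hcpos]
        refine and_congr_right fun _ => ?_
        have e2 : ‖c • z‖ ^ 2 + (c * (b * ‖z‖)) ^ 2 = ‖z‖ ^ 2 := by
          rw [norm_smul, Real.norm_of_nonneg hcpos.le]
          calc _ = (c ^ 2 * (1 + b ^ 2)) * ‖z‖ ^ 2 := by ring
            _ = _ := by rw [hc2, one_mul]
        simp only [hBdef, Set.mem_ofPred_eq, Prod.smul_fst, Prod.smul_snd, smul_eq_mul]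
        rw [e2]
        simp
      by_cases h1 : (z, b * ‖z‖) ∈ D <;> by_cases h2 : z ∈ Metric.ball (0 : F) 1
      · rw [Set.indicator_of_mem (show (c • z, b) ∈ _ from hmem.2 ⟨h1, h2⟩),
          Set.indicator_of_mem h2,
          Set.indicator_of_mem (show (z, b) ∈ {p : F × ℝ | (p.1, p.2 * ‖p.1‖) ∈ D} from h1)]
        simp only [Pi.one_apply, mul_one]
        rw [norm_smul, Real.norm_of_nonneg hcpos.le, ← ENNReal.ofReal_mul (by positivity),
          ← ENNReal.ofReal_mul (by positivity)]
        congr 1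
        ring
      all_goals
        rw [Set.indicator_of_notMem (show (c • z, b) ∉ _ from fun h => by
          have := hmem.1 h; tauto)]
      · simp [Set.indicator_of_notMem h2]
      · rw [Set.indicator_of_notMem
          (show (z, b) ∉ {p : F × ℝ | (p.1, p.2 * ‖p.1‖) ∈ D} from h1)]
        simp
      · simp [Set.indicator_of_notMem h2]
    · simp
  simp_rw [step2]
  have hwm : Measurable fun b : ℝ =>
      ENNReal.ofReal ((√(1 + b ^ 2))⁻¹ ^ (Module.finrank ℝ F + 1)) := by fun_prop
  rw [lintegral_lintegral_swap]
  swap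
  · refine Measurable.aemeasurable ?_
    refine Measurable.mul (Measurable.mul (by fun_prop) ?_) (Measurable.mul ?_ ?_)
    · exact (measurable_one.indicator measurableSet_ball).comp measurable_snd
    · exact hwm.comp measurable_fst
    · exact (measurable_one.indicator hDm).comp measurable_swap
  refine lintegral_congr fun z => ?_
  have hDz : MeasurableSet {b : ℝ | (z, b * ‖z‖) ∈ D} := measurable_prodMk_left hDm
  rw [lintegral_const_mul']
  · congr 1
    rw [slopeMeasure, withDensity_apply _ hDz, ← lintegral_indicator hDz]
    refine lintegral_congr fun b => ?_
    by_cases h1 : (z, b * ‖z‖) ∈ D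
    · rw [Set.indicator_of_mem (show (z, b) ∈ {p : F × ℝ | (p.1, p.2 * ‖p.1‖) ∈ D} from h1),
        Set.indicator_of_mem (show b ∈ {b : ℝ | (z, b * ‖z‖) ∈ D} from h1)]
      simp
    · rw [Set.indicator_of_notMem (show (z, b) ∉ {p : F × ℝ | (p.1, p.2 * ‖p.1‖) ∈ D} from h1),
        Set.indicator_of_notMem (show b ∉ {b : ℝ | (z, b * ‖z‖) ∈ D} from h1)]
      simp
  · refine ENNReal.mul_ne_top (by simp) ?_
    by_cases h2 : z ∈ Metric.ball (0 : F) 1 <;> simp [h2]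

/-- One-dimensional correlation inequality. -/
lemma corr_aux (m : Measure ℝ) (U P Q : Set ℝ) (hQ : MeasurableSet Q)
    (hUP : U ⊆ P) (hU : ∀ a ∈ U, ∀ b, a ≤ b → b ∈ U)
    (hPQ : ∀ a ∈ P, ∀ b ∈ Q, a ≤ b → a ∈ Q) :
    m (U ∩ Q) * m P ≤ m U * m (P ∩ Q) := by
  rcases (U ∩ Q).eq_empty_or_nonempty with h | ⟨x, hxU, hxQ⟩
  · simp [h]
  have hsub : P \ Q = U \ Q := by
    ext y
    refine ⟨fun ⟨hyP, hyQ⟩ => ⟨hU x hxU y ?_, hyQ⟩, fun ⟨hyU, hyQ⟩ => ⟨hUP hyU, hyQ⟩⟩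
    by_contra hlt
    exact hyQ (hPQ y hyP x hxQ (not_le.1 hlt).le)
  have e1 := measure_inter_add_sdiff (μ := m) P hQ
  have e2 := measure_inter_add_sdiff (μ := m) U hQ
  rw [← e1, ← e2, hsub, mul_add, add_mul]
  refine add_le_add le_rfl ((mul_comm _ _).trans_le ?_)
  gcongr

lemma slope_mono {s : ℝ} (hs : 0 ≤ s) {a b : ℝ} (ha : 0 ≤ a) (hab : a ≤ b)
    (hb : b ≤ s * √(1 + b ^ 2)) : a ≤ s * √(1 + a ^ 2) := by
  have h1 : b ^ 2 ≤ s ^ 2 * (1 + b ^ 2) := by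
    have := pow_le_pow_left₀ (ha.trans hab) hb 2
    rwa [mul_pow, Real.sq_sqrt (by positivity)] at this
  refine le_of_sq_le_sq ?_ (by positivity)
  rw [mul_pow, Real.sq_sqrt (by positivity)]
  have hab2 : a ^ 2 ≤ b ^ 2 := by gcongr
  by_cases hs1 : s ^ 2 ≤ 1
  · nlinarith
  · nlinarith [sq_nonneg a]

lemma cyl_corr [Nontrivial F] (V : Set (F × ℝ)) (hV : MeasurableSet V)
    (hcone : ∀ t : ℝ, 0 < t → ∀ p ∈ V, t • p ∈ V)
    (hup : ∀ y a b, a ≤ b → (y, a) ∈ V → (y, b) ∈ V)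
    (hH : ∀ p ∈ V, 0 ≤ p.2) {s : ℝ} (hs : 0 ≤ s) :
    let ν := (volume : Measure F).prod (volume : Measure ℝ)
    let B := {p : F × ℝ | ‖p.1‖ ^ 2 + p.2 ^ 2 < 1}
    let A := {p : F × ℝ | p.2 ≤ s * √(‖p.1‖ ^ 2 + p.2 ^ 2)}
    let H := {p : F × ℝ | 0 ≤ p.2}
    ν ((V ∩ A) ∩ B) * ν (H ∩ B) ≤ ν (V ∩ B) * ν ((H ∩ A) ∩ B) := by
  intro ν B A H
  have hA : MeasurableSet A := (isClosed_le (by fun_prop) (by fun_prop)).measurableSet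
  have hHm : MeasurableSet H := (isClosed_le (by fun_prop) (by fun_prop)).measurableSet
  have hAc : ∀ t : ℝ, 0 < t → ∀ p ∈ A, t • p ∈ A := by
    intro t ht p hp
    simp only [A, Set.mem_ofPred_eq, Prod.smul_fst, Prod.smul_snd, smul_eq_mul, norm_smul,
      Real.norm_of_nonneg ht.le] at hp ⊢
    have : (t * ‖p.1‖) ^ 2 + (t * p.2) ^ 2 = t ^ 2 * (‖p.1‖ ^ 2 + p.2 ^ 2) := by ring
    rw [this, Real.sqrt_mul (by positivity), Real.sqrt_sq ht.le]
    nlinarith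
  have hHc : ∀ t : ℝ, 0 < t → ∀ p ∈ H, t • p ∈ H := by
    intro t ht p hp
    simp only [H, Set.mem_ofPred_eq, Prod.smul_snd, smul_eq_mul] at hp ⊢
    positivity
  set m := slopeMeasure (Module.finrank ℝ F)
  set Q : Set ℝ := {b | b ≤ s * √(1 + b ^ 2)} with hQdef
  have hQ : MeasurableSet Q := (isClosed_le (by fun_prop) (by fun_prop)).measurableSet
  set P : Set ℝ := Set.Ici 0
  have hAz : ∀ z : F, z ≠ 0 → ∀ b : ℝ, ((z, b * ‖z‖) ∈ A ↔ b ∈ Q) := by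
    intro z hz b
    have hz' : 0 < ‖z‖ := norm_pos_iff.2 hz
    simp only [A, hQdef, Set.mem_ofPred_eq]
    have : ‖z‖ ^ 2 + (b * ‖z‖) ^ 2 = (1 + b ^ 2) * ‖z‖ ^ 2 := by ring
    rw [this, Real.sqrt_mul (by positivity), Real.sqrt_sq hz'.le, ← mul_assoc]
    exact mul_le_mul_iff_left₀ hz'
  have hHz : ∀ z : F, z ≠ 0 → ∀ b : ℝ, ((z, b * ‖z‖) ∈ H ↔ b ∈ P) := by
    intro z hz b
    have hz' : 0 < ‖z‖ := norm_pos_iff.2 hz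
    simp only [H, P, Set.mem_ofPred_eq, Set.mem_Ici]
    exact mul_nonneg_iff_of_pos_right hz'
  have h0 : ∀ᵐ y : F, y ≠ 0 := by
    rw [ae_iff]; simp
  set W : F → ENNReal := fun z => ENNReal.ofReal ‖z‖ * (Metric.ball (0 : F) 1).indicator 1 z
    with hW
  have hWm : Measurable W := by
    refine Measurable.mul (by fun_prop) (measurable_one.indicator measurableSet_ball)
  have eH : ν (H ∩ B) = (∫⁻ z, W z) * m P := by
    rw [cone_formula H hHm hHc, ← lintegral_mul_const _ hWm]
    refine lintegral_congr_ae ?_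
    filter_upwards [h0] with z hz
    congr 2
    ext b
    exact hHz z hz b
  have eHA : ν ((H ∩ A) ∩ B) = (∫⁻ z, W z) * m (P ∩ Q) := by
    rw [cone_formula (H ∩ A) (hHm.inter hA) (fun t ht p hp => ⟨hHc t ht p hp.1, hAc t ht p hp.2⟩),
      ← lintegral_mul_const _ hWm]
    refine lintegral_congr_ae ?_
    filter_upwards [h0] with z hz
    congr 2
    ext b
    exact and_congr (hHz z hz b) (hAz z hz b)
  have main : ν ((V ∩ A) ∩ B) * m P ≤ ν (V ∩ B) * m (P ∩ Q) := by
    have hmap : Measurable fun p : F × ℝ => (p.1, p.2 * ‖p.1‖) := by fun_prop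
    have : SFinite m := by unfold m slopeMeasure; infer_instance
    rw [cone_formula (V ∩ A) (hV.inter hA) (fun t ht p hp => ⟨hcone t ht p hp.1, hAc t ht p hp.2⟩),
      cone_formula V hV hcone, ← lintegral_mul_const, ← lintegral_mul_const]
    · refine lintegral_mono_ae ?_
      filter_upwards [h0] with z hz
      have hz' : 0 < ‖z‖ := norm_pos_iff.2 hz
      change W z * _ * _ ≤ W z * _ * _
      rw [mul_assoc (W z), mul_assoc (W z)]
      refine mul_le_mul' le_rfl ?_
      have e : {b : ℝ | (z, b * ‖z‖) ∈ V ∩ A} = {b : ℝ | (z, b * ‖z‖) ∈ V} ∩ Q := by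
        ext b
        exact and_congr Iff.rfl (hAz z hz b)
      rw [e]
      refine corr_aux m _ P Q hQ ?_ ?_ ?_
      · intro b hb
        exact (hHz z hz b).1 (hH _ hb)
      · intro a ha b hab
        exact hup _ _ _ (mul_le_mul_of_nonneg_right hab hz'.le) ha
      · intro a ha b hb hab
        exact slope_mono hs ha hab hb
    · exact hWm.mul (measurable_measure_prodMk_left (hmap hV))
    · exact hWm.mul (measurable_measure_prodMk_left (hmap (hV.inter hA)))
  rw [eH, eHA]
  calc _ = (∫⁻ z, W z) * (ν ((V ∩ A) ∩ B) * m P) := by ring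
    _ ≤ (∫⁻ z, W z) * (ν (V ∩ B) * m (P ∩ Q)) := by gcongr
    _ = _ := by ring

end Cyl

section Sph

variable {E : Type*} [NormedAddCommGroup E] [InnerProductSpace ℝ E] [FiniteDimensional ℝ E]
  [MeasurableSpace E] [BorelSpace E]

lemma euclid_corr (hdim : 2 ≤ Module.finrank ℝ E) (u : E) (hu : ‖u‖ = 1)
    (V : Set E) (hV : MeasurableSet V)
    (hcone : ∀ t : ℝ, 0 < t → ∀ p ∈ V, t • p ∈ V)
    (hup : ∀ x ∈ V, ∀ a : ℝ, 0 ≤ a → x + a • u ∈ V)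
    (hH : ∀ x ∈ V, 0 ≤ ⟪u, x⟫) {s : ℝ} (hs : 0 ≤ s) :
    volume ((V ∩ {x | ⟪u, x⟫ ≤ s * ‖x‖}) ∩ Metric.ball 0 1) *
      volume ({x | 0 ≤ ⟪u, x⟫} ∩ Metric.ball (0 : E) 1) ≤
    volume (V ∩ Metric.ball 0 1) *
      volume (({x | 0 ≤ ⟪u, x⟫} ∩ {x | ⟪u, x⟫ ≤ s * ‖x‖}) ∩ Metric.ball (0 : E) 1) := by
  let F := (Submodule.span ℝ {u})ᗮ
  have hu2 : ⟪u, u⟫ = 1 := by rw [real_inner_self_eq_norm_sq, hu, one_pow]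
  have hu0 : u ≠ 0 := by rintro rfl; simp at hu
  have hF : ∀ y : F, ⟪u, (y : E)⟫ = 0 := fun y =>
    Submodule.mem_orthogonal_singleton_iff_inner_right.1 y.2
  have hfr : Module.finrank ℝ F + 1 = Module.finrank ℝ E := by
    have h1 := Submodule.finrank_add_finrank_orthogonal (Submodule.span ℝ {u})
    rw [finrank_span_singleton hu0] at h1
    rw [← h1, add_comm]
  have : Nontrivial F := Module.nontrivial_of_finrank_pos (R := ℝ) (by omega)
  let L0 : F × ℝ →ₗ[ℝ] E := LinearMap.coprod F.subtype (LinearMap.toSpanSingleton ℝ E u)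
  have hL0 : ∀ p, L0 p = (p.1 : E) + p.2 • u := fun p => by simp [L0]
  have hinner : ∀ p, ⟪u, L0 p⟫ = p.2 := by
    intro p
    rw [hL0, inner_add_right, hF, real_inner_smul_right, hu2]; ring
  have hbij : Function.Bijective L0 := by
    constructor
    · rw [injective_iff_map_eq_zero]
      intro p hp
      have h2 : p.2 = 0 := by rw [← hinner p, hp, inner_zero_right]
      have h1 := hL0 p
      rw [hp, h2, zero_smul, add_zero] at h1
      exact Prod.ext (Subtype.ext h1.symm) h2
    · intro x
      refine ⟨(⟨x - ⟪u, x⟫ • u, ?_⟩, ⟪u, x⟫), ?_⟩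
      · rw [Submodule.mem_orthogonal_singleton_iff_inner_right, inner_sub_right,
          real_inner_smul_right, hu2]; ring
      · rw [hL0]; simp
  let L : (F × ℝ) ≃L[ℝ] E := (LinearEquiv.ofBijective L0 hbij).toContinuousLinearEquiv
  have hL : ∀ p, L p = (p.1 : E) + p.2 • u := hL0
  have hLi : ∀ p, ⟪u, L p⟫ = p.2 := hinner
  have hLn : ∀ p, ‖L p‖ ^ 2 = ‖p.1‖ ^ 2 + p.2 ^ 2 := by
    intro p
    rw [hL, norm_add_sq_real, norm_smul, real_inner_smul_right, real_inner_comm, hF, hu]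
    simp
  have hLn' : ∀ p, ‖L p‖ = √(‖p.1‖ ^ 2 + p.2 ^ 2) := by
    intro p
    rw [← hLn, Real.sqrt_sq (norm_nonneg _)]
  let ν := (volume : Measure F).prod (volume : Measure ℝ)
  have hν : (Measure.map L ν).IsAddHaarMeasure := L.isAddHaarMeasure_map ν
  have hvol := Measure.isAddLeftInvariant_eq_smul (volume : Measure E) (Measure.map L ν)
  set c := Measure.addHaarScalarFactor (volume : Measure E) (Measure.map L ν)
  have hB : L ⁻¹' (Metric.ball 0 1) = {p : F × ℝ | ‖p.1‖ ^ 2 + p.2 ^ 2 < 1} := by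
    ext p
    simp only [Set.mem_preimage, mem_ball_zero_iff, Set.mem_ofPred_eq, ← hLn]
    rw [sq_lt_one_iff₀ (norm_nonneg _)]
  have hA : L ⁻¹' {x | ⟪u, x⟫ ≤ s * ‖x‖} =
      {p : F × ℝ | p.2 ≤ s * √(‖p.1‖ ^ 2 + p.2 ^ 2)} := by
    ext p
    simp only [Set.mem_preimage, Set.mem_ofPred_eq, hLi, hLn']
  have hHH : L ⁻¹' {x | 0 ≤ ⟪u, x⟫} = {p : F × ℝ | 0 ≤ p.2} := by
    ext p
    simp only [Set.mem_preimage, Set.mem_ofPred_eq, hLi]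
  have hLm : MeasurableEmbedding L := L.toHomeomorph.measurableEmbedding
  have key : ∀ D : Set E, volume D = c * ν (L ⁻¹' D) := by
    intro D
    conv_lhs => rw [hvol]
    rw [Measure.smul_apply, hLm.map_apply]
    rfl
  rw [key, key, key, key]
  simp only [Set.preimage_inter, hA, hB, hHH]
  have := cyl_corr (F := F) (L ⁻¹' V) (L.continuous.measurable hV)
    (fun t ht p hp => by
      change L (t • p) ∈ V
      rw [map_smul]; exact hcone t ht _ hp)
    (fun y a b hab h => by
      change L (y, b) ∈ V
      have h2 := hup _ h (b - a) (sub_nonneg.2 hab)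
      convert h2 using 1
      rw [hL, hL, sub_smul]; simp)
    (fun p hp => by rw [← hLi]; exact hH _ hp) hs
  simp only at this
  calc _ = (c : ENNReal) * c * (ν (L ⁻¹' V ∩ {p : F × ℝ | p.2 ≤ s * √(‖p.1‖ ^ 2 + p.2 ^ 2)} ∩
          {p : F × ℝ | ‖p.1‖ ^ 2 + p.2 ^ 2 < 1}) *
          ν ({p : F × ℝ | 0 ≤ p.2} ∩ {p : F × ℝ | ‖p.1‖ ^ 2 + p.2 ^ 2 < 1})) := by ring
    _ ≤ _ := mul_le_mul' le_rfl this
    _ = _ := by ring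

lemma exists_rot (u v : E) (hu : ‖u‖ = 1) (hv : ‖v‖ = 1) : ∃ O : E ≃ₗᵢ[ℝ] E, O u = v :=
  ⟨_, Submodule.reflection_sub (hu.trans hv.symm)⟩

lemma hyper_null (v : E) (hv : v ≠ 0) : volume {x : E | ⟪v, x⟫ = 0} = 0 := by
  have : {x : E | ⟪v, x⟫ = 0} = ((Submodule.span ℝ {v})ᗮ : Submodule ℝ E) := by
    ext x
    exact Submodule.mem_orthogonal_singleton_iff_inner_right.symm
  rw [this]
  refine Measure.addHaar_submodule _ _ ?_
  intro h
  have : v ∈ (Submodule.span ℝ {v})ᗮ := by rw [h]; trivial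
  rw [Submodule.mem_orthogonal_singleton_iff_inner_right, inner_self_eq_zero] at this
  exact hv this

lemma cap_ineq (hdim : 2 ≤ Module.finrank ℝ E) (u : E) (hu : ‖u‖ = 1)
    (S : Finset E) (w : E → ℝ) (hw : ∀ v ∈ S, 0 ≤ w v) (hw1 : ∑ v ∈ S, w v = 1)
    (hw0 : ∑ v ∈ S, w v • v = 0) (hS : ∀ v ∈ S, ‖v‖ = 1) {s : ℝ} (hs : 0 ≤ s) :
    volume ({x : E | ∀ v ∈ S, ⟪v, x⟫ ≤ s * ‖x‖} ∩ Metric.ball 0 1) ≤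
      volume ({x : E | |⟪u, x⟫| ≤ s * ‖x‖} ∩ Metric.ball 0 1) := by
  classical
  set B := Metric.ball (0 : E) 1 with hBdef
  have hBm : MeasurableSet B := measurableSet_ball
  let A : E → Set E := fun v => {x | ⟪v, x⟫ ≤ s * ‖x‖}
  let H : E → Set E := fun v => {x | 0 ≤ ⟪v, x⟫}
  have hAm : ∀ v, MeasurableSet (A v) := fun v =>
    (isClosed_le (by fun_prop) (by fun_prop)).measurableSet
  have hHm : ∀ v, MeasurableSet (H v) := fun v =>
    (isClosed_le (by fun_prop) (by fun_prop)).measurableSet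
  let V : E → Set E := fun v => ⋂ z ∈ S, {x | ⟪z, x⟫ ≤ ⟪v, x⟫}
  have hVm : ∀ v, MeasurableSet (V v) := fun v =>
    (isClosed_biInter fun z _ => isClosed_le (by fun_prop) (by fun_prop)).measurableSet
  have hSne : S.Nonempty := by
    by_contra h
    rw [Finset.not_nonempty_iff_eq_empty] at h
    simp [h] at hw1
  have hVH : ∀ v, ∀ x ∈ V v, 0 ≤ ⟪v, x⟫ := by
    intro v x hx
    have h1 : ∑ z ∈ S, w z * ⟪z, x⟫ = 0 := by
      have : ⟪∑ z ∈ S, w z • z, x⟫ = 0 := by rw [hw0, inner_zero_left]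
      rw [sum_inner] at this
      simpa only [real_inner_smul_left] using this
    have h2 : ∑ z ∈ S, w z * ⟪z, x⟫ ≤ ∑ z ∈ S, w z * ⟪v, x⟫ :=
      Finset.sum_le_sum fun z hz => mul_le_mul_of_nonneg_left
        (by simpa using Set.mem_iInter₂.1 hx z hz) (hw z hz)
    rw [h1, ← Finset.sum_mul, hw1, one_mul] at h2
    exact h2
  have hcover : ∀ x : E, ∃ v ∈ S, x ∈ V v := by
    intro x
    obtain ⟨v, hv, hmax⟩ := S.exists_max_image (fun z => ⟪z, x⟫) hSne
    exact ⟨v, hv, Set.mem_iInter₂.2 fun z hz => hmax z hz⟩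
  -- rotation invariance
  have rotH : ∀ v, ‖v‖ = 1 → volume (H v ∩ B) = volume (H u ∩ B) ∧
      volume ((H v ∩ A v) ∩ B) = volume ((H u ∩ A u) ∩ B) := by
    intro v hv
    obtain ⟨O, hO⟩ := exists_rot u v hu hv
    have hmp := O.measurePreserving
    have hi : ∀ x, ⟪v, O x⟫ = ⟪u, x⟫ := fun x => by rw [← hO, O.inner_map_map]
    constructor
    · rw [← hmp.measure_preimage ((hHm v).inter hBm).nullMeasurableSet]
      congr 1
      ext x
      simp [H, hBdef, hi]
    · rw [← hmp.measure_preimage (((hHm v).inter (hAm v)).inter hBm).nullMeasurableSet]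
      congr 1
      ext x
      simp [H, A, hBdef, hi]
  have hu0 : u ≠ 0 := by rintro rfl; simp at hu
  have hcorr : ∀ v ∈ S, volume ((V v ∩ A v) ∩ B) * volume (H u ∩ B) ≤
      volume (V v ∩ B) * volume ((H u ∩ A u) ∩ B) := by
    intro v hv
    have hv1 := hS v hv
    rw [← (rotH v hv1).1, ← (rotH v hv1).2]
    refine euclid_corr hdim v hv1 (V v) (hVm v) ?_ ?_ (hVH v) hs
    · intro t ht x hx
      refine Set.mem_iInter₂.2 fun z hz => ?_
      have : ⟪z, x⟫ ≤ ⟪v, x⟫ := Set.mem_iInter₂.1 hx z hz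
      simp only [Set.mem_ofPred_eq, real_inner_smul_right]
      gcongr
    · intro x hx a ha
      refine Set.mem_iInter₂.2 fun z hz => ?_
      have h1 : ⟪z, x⟫ ≤ ⟪v, x⟫ := Set.mem_iInter₂.1 hx z hz
      have h2 : ⟪z, v⟫ ≤ ⟪v, v⟫ := by
        have := real_inner_le_norm z v
        rw [real_inner_self_eq_norm_sq, hv1]
        rw [hS z hz, hv1] at this
        simpa using this
      simp only [Set.mem_ofPred_eq, inner_add_right, real_inner_smul_right]
      gcongr
  have hsum : ∑ v ∈ S, volume (V v ∩ B) ≤ volume B := by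
    rw [← measure_biUnion_finset₀]
    · exact measure_mono (Set.iUnion₂_subset fun v _ => Set.inter_subset_right)
    · intro v hv z hz hvz
      refine measure_mono_null ?_ (hyper_null (v - z) (sub_ne_zero.2 hvz))
      rintro x ⟨⟨hx1, -⟩, ⟨hx2, -⟩⟩
      have h1 : ⟪z, x⟫ ≤ ⟪v, x⟫ := Set.mem_iInter₂.1 hx1 z hz
      have h2 : ⟪v, x⟫ ≤ ⟪z, x⟫ := Set.mem_iInter₂.1 hx2 v hv
      simp only [Set.mem_ofPred_eq, inner_sub_left]
      linarith
    · exact fun v _ => ((hVm v).inter hBm).nullMeasurableSet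
  have hneg : MeasurePreserving (LinearIsometryEquiv.neg ℝ : E ≃ₗᵢ[ℝ] E) volume volume :=
    LinearIsometryEquiv.measurePreserving _
  have hBle : volume B ≤ 2 * volume (H u ∩ B) := by
    have h1 : volume ((LinearIsometryEquiv.neg ℝ : E ≃ₗᵢ[ℝ] E) ⁻¹' (H u ∩ B)) =
        volume (H u ∩ B) := hneg.measure_preimage ((hHm u).inter hBm).nullMeasurableSet
    rw [two_mul]
    nth_rewrite 2 [← h1]
    refine (measure_mono ?_).trans (measure_union_le _ _)
    intro x hx
    rcases le_total 0 ⟪u, x⟫ with h | h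
    · exact Or.inl ⟨h, hx⟩
    · refine Or.inr ⟨?_, ?_⟩
      · simpa [H] using h
      · simpa [hBdef] using hx
  have hTge : 2 * volume ((H u ∩ A u) ∩ B) ≤ volume ({x : E | |⟪u, x⟫| ≤ s * ‖x‖} ∩ B) := by
    have hm := ((hHm u).inter (hAm u)).inter hBm
    have h1 : volume ((LinearIsometryEquiv.neg ℝ : E ≃ₗᵢ[ℝ] E) ⁻¹' ((H u ∩ A u) ∩ B)) =
        volume ((H u ∩ A u) ∩ B) := hneg.measure_preimage hm.nullMeasurableSet
    rw [two_mul]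
    nth_rewrite 2 [← h1]
    rw [← measure_union₀ (hneg.measurable hm).nullMeasurableSet]
    · refine measure_mono ?_
      rintro x (⟨⟨h1, h2⟩, h3⟩ | ⟨⟨h1, h2⟩, h3⟩)
      · refine ⟨?_, h3⟩
        simp only [H, A, Set.mem_ofPred_eq] at h1 h2 ⊢
        rwa [abs_of_nonneg h1]
      · simp [H, A, hBdef] at h1 h2 h3
        refine ⟨?_, by simpa [hBdef] using h3⟩
        simp only [Set.mem_ofPred_eq]
        rw [abs_of_nonpos h1]; linarith
    · refine measure_mono_null ?_ (hyper_null u hu0)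
      rintro x ⟨⟨⟨h1, -⟩, -⟩, ⟨⟨h2, -⟩, -⟩⟩
      simp [H] at h1 h2
      exact le_antisymm h2 h1
  have hfin : volume (H u ∩ B) ≠ ⊤ :=
    ((measure_mono Set.inter_subset_right).trans_lt measure_ball_lt_top).ne
  have hpos : volume (H u ∩ B) ≠ 0 := by
    intro h
    rw [h, mul_zero] at hBle
    exact (Metric.measure_ball_pos volume (0 : E) one_pos).ne' (le_antisymm hBle zero_le)
  have hle : volume ({x : E | ∀ v ∈ S, ⟪v, x⟫ ≤ s * ‖x‖} ∩ B) ≤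
      ∑ v ∈ S, volume ((V v ∩ A v) ∩ B) := by
    refine (measure_mono ?_).trans (measure_biUnion_finset_le S _)
    rintro x ⟨hx, hxB⟩
    obtain ⟨v, hv, hxv⟩ := hcover x
    exact Set.mem_iUnion₂.2 ⟨v, hv, ⟨hxv, hx v hv⟩, hxB⟩
  have hfinal : volume ({x : E | ∀ v ∈ S, ⟪v, x⟫ ≤ s * ‖x‖} ∩ B) * volume (H u ∩ B) ≤
      volume ({x : E | |⟪u, x⟫| ≤ s * ‖x‖} ∩ B) * volume (H u ∩ B) := by
    calc _ ≤ (∑ v ∈ S, volume ((V v ∩ A v) ∩ B)) * volume (H u ∩ B) := by gcongr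
      _ = ∑ v ∈ S, volume ((V v ∩ A v) ∩ B) * volume (H u ∩ B) := Finset.sum_mul ..
      _ ≤ ∑ v ∈ S, volume (V v ∩ B) * volume ((H u ∩ A u) ∩ B) := Finset.sum_le_sum hcorr
      _ = (∑ v ∈ S, volume (V v ∩ B)) * volume ((H u ∩ A u) ∩ B) := (Finset.sum_mul ..).symm
      _ ≤ (2 * volume (H u ∩ B)) * volume ((H u ∩ A u) ∩ B) := by
        gcongr; exact hsum.trans hBle
      _ = (2 * volume ((H u ∩ A u) ∩ B)) * volume (H u ∩ B) := by ring
      _ ≤ _ := by gcongr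
  exact (ENNReal.mul_le_mul_iff_left hpos hfin).1 hfinal

end Sph

section Radial

variable {E : Type*} [NormedAddCommGroup E] [InnerProductSpace ℝ E] [FiniteDimensional ℝ E]
  [MeasurableSpace E] [BorelSpace E]

lemma exists_density (μ : Measure E) [IsLocallyFiniteMeasure μ] (hac : μ ≪ volume)
    (hinv : ∀ O : E ≃ₗᵢ[ℝ] E, Measure.map O μ = μ) :
    ∃ h : E → ENNReal, Measurable h ∧ (∀ (O : E ≃ₗᵢ[ℝ] E) x, h (O x) = h x) ∧
      μ = volume.withDensity h := by
  let q : ℕ → E → ENNReal := fun k x =>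
    μ (Metric.closedBall x (1 / ((k : ℝ) + 1))) / volume (Metric.closedBall x (1 / ((k : ℝ) + 1)))
  let h : E → ENNReal := fun x => Filter.limsup (fun k => q k x) Filter.atTop
  have hmeas : ∀ (ρ : Measure E) [SFinite ρ] (a : ℝ),
      Measurable fun x => ρ (Metric.closedBall x a) := by
    intro ρ _ a
    have hs : MeasurableSet {p : E × E | dist p.2 p.1 ≤ a} :=
      (isClosed_le (by fun_prop) (by fun_prop)).measurableSet
    exact measurable_measure_prodMk_left hs
  have hpre : ∀ (O : E ≃ₗᵢ[ℝ] E) x a,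
      O ⁻¹' (Metric.closedBall (O x) a) = Metric.closedBall x a := by
    intro O x a
    ext y
    simp [Metric.mem_closedBall]
  refine ⟨h, ?_, ?_, ?_⟩
  · exact Measurable.limsup fun k => (hmeas μ _).div (hmeas volume _)
  · intro O x
    have hμ : ∀ a, μ (Metric.closedBall (O x) a) = μ (Metric.closedBall x a) := by
      intro a
      conv_lhs => rw [← hinv O]
      rw [Measure.map_apply O.continuous.measurable measurableSet_closedBall, hpre]
    have hv : ∀ a, volume (Metric.closedBall (O x) a) = volume (Metric.closedBall x a) := by
      intro a
      rw [← O.measurePreserving.measure_preimage measurableSet_closedBall.nullMeasurableSet, hpre]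
    simp only [h, q, hμ, hv]
  · rw [← Measure.withDensity_rnDeriv_eq μ volume hac]
    refine withDensity_congr_ae ?_
    filter_upwards [Besicovitch.ae_tendsto_rnDeriv μ volume] with x hx
    have ht : Filter.Tendsto (fun k : ℕ => 1 / ((k : ℝ) + 1)) Filter.atTop
        (nhdsWithin 0 (Set.Ioi 0)) := by
      refine tendsto_nhdsWithin_iff.2 ⟨tendsto_one_div_add_atTop_nhds_zero_nat, ?_⟩
      exact Filter.Eventually.of_forall fun k => by simp only [Set.mem_Ioi]; positivity
    exact (hx.comp ht).limsup_eq.symm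

lemma lintegral_polar [Nontrivial E] (f : E → ENNReal) (hf : Measurable f) :
    ∫⁻ x, f x = ∫⁻ t : Set.Ioi (0 : ℝ), ∫⁻ ξ : Metric.sphere (0 : E) 1, f (t.1 • ξ.1)
      ∂(volume : Measure E).toSphere ∂(Measure.volumeIoiPow (Module.finrank ℝ E - 1)) := by
  have hmp := (volume : Measure E).measurePreserving_homeomorphUnitSphereProd
  have h1 : ∫⁻ x, f x = ∫⁻ x : ({0}ᶜ : Set E), f x.1 ∂(Measure.comap Subtype.val volume) := by
    rw [lintegral_subtype_comap (measurableSet_singleton _).compl, restrict_compl_singleton]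
  have hG : Measurable fun p : Metric.sphere (0 : E) 1 × Set.Ioi (0 : ℝ) => f (p.2.1 • p.1.1) :=
    hf.comp (by fun_prop)
  have h2 := hmp.lintegral_comp_emb (Homeomorph.measurableEmbedding _)
    (fun p : Metric.sphere (0 : E) 1 × Set.Ioi (0 : ℝ) => f (p.2.1 • p.1.1))
  rw [lintegral_prod_symm' _ hG] at h2
  rw [h1, ← h2]
  refine lintegral_congr fun x => ?_
  congr 1
  have hx : ‖(x : E)‖ ≠ 0 := norm_ne_zero_iff.2 x.2
  simp [smul_smul, hx]

lemma sphere_ineq (hdim : 2 ≤ Module.finrank ℝ E) (u : E) (hu : ‖u‖ = 1)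
    (S : Finset E) (w : E → ℝ) (hw : ∀ v ∈ S, 0 ≤ w v) (hw1 : ∑ v ∈ S, w v = 1)
    (hw0 : ∑ v ∈ S, w v • v = 0) (hS : ∀ v ∈ S, ‖v‖ = 1) {s : ℝ} (hs : 0 ≤ s) :
    (volume : Measure E).toSphere {ξ | ∀ v ∈ S, ⟪v, ξ.1⟫ ≤ s} ≤
      (volume : Measure E).toSphere {ξ | |⟪u, ξ.1⟫| ≤ s} := by
  have : Nontrivial E := Module.nontrivial_of_finrank_pos (R := ℝ) (by omega)
  have hm1 : MeasurableSet {ξ : Metric.sphere (0 : E) 1 | ∀ v ∈ S, ⟪v, ξ.1⟫ ≤ s} := by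
    have : {ξ : Metric.sphere (0 : E) 1 | ∀ v ∈ S, ⟪v, ξ.1⟫ ≤ s} =
        ⋂ v ∈ S, {ξ : Metric.sphere (0 : E) 1 | ⟪v, ξ.1⟫ ≤ s} := by ext; simp
    rw [this]
    exact (isClosed_biInter fun z _ => isClosed_le (by fun_prop) (by fun_prop)).measurableSet
  have hm2 : MeasurableSet {ξ : Metric.sphere (0 : E) 1 | |⟪u, ξ.1⟫| ≤ s} :=
    (isClosed_le (by fun_prop) (by fun_prop)).measurableSet
  rw [Measure.toSphere_apply' _ hm1, Measure.toSphere_apply' _ hm2]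
  refine mul_le_mul' le_rfl ?_
  calc _ ≤ volume ({x : E | ∀ v ∈ S, ⟪v, x⟫ ≤ s * ‖x‖} ∩ Metric.ball 0 1) := by
        refine measure_mono ?_
        rintro x ⟨t, ⟨ht0, ht1⟩, y, ⟨ξ, hξ, rfl⟩, rfl⟩
        have hn : ‖ξ.1‖ = 1 := by simpa using ξ.2
        have hn2 : ‖t • ξ.1‖ = t := by rw [norm_smul, hn, mul_one, Real.norm_of_nonneg ht0.le]
        refine ⟨fun v hv => ?_, ?_⟩
        · change ⟪v, t • ξ.1⟫ ≤ s * ‖t • ξ.1‖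
          rw [hn2, real_inner_smul_right, mul_comm]
          exact mul_le_mul_of_nonneg_right (hξ v hv) ht0.le
        · change t • ξ.1 ∈ _
          rwa [mem_ball_zero_iff, hn2]
    _ ≤ volume ({x : E | |⟪u, x⟫| ≤ s * ‖x‖} ∩ Metric.ball 0 1) :=
        cap_ineq hdim u hu S w hw hw1 hw0 hS hs
    _ = volume (({x : E | |⟪u, x⟫| ≤ s * ‖x‖} ∩ Metric.ball 0 1) \ {0}) :=
        (measure_sdiff_null (measure_singleton _)).symm
    _ ≤ _ := by
        refine measure_mono ?_
        rintro x ⟨⟨hx1, hx2⟩, hx0⟩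
        have hx0' : 0 < ‖x‖ := norm_pos_iff.2 hx0
        rw [mem_ball_zero_iff] at hx2
        have hn : ‖‖x‖⁻¹ • x‖ = 1 := by
          rw [norm_smul, norm_inv, norm_norm, inv_mul_cancel₀ hx0'.ne']
        refine ⟨‖x‖, ⟨hx0', hx2⟩, ‖x‖⁻¹ • x, ⟨⟨‖x‖⁻¹ • x, by simpa using hn⟩, ?_, rfl⟩, ?_⟩
        · change |⟪u, ‖x‖⁻¹ • x⟫| ≤ s
          rw [real_inner_smul_right, abs_mul, abs_of_pos (by positivity), inv_mul_le_iff₀ hx0',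
            mul_comm]
          exact hx1
        · simp [smul_smul, hx0'.ne']

lemma main_ge_two (hdim : 2 ≤ Module.finrank ℝ E) (μ : Measure E) (hac : μ ≪ volume)
    (hinv : ∀ O : E ≃ₗᵢ[ℝ] E, Measure.map O μ = μ)
    (K : Set E) (hKm : MeasurableSet K) {r : ℝ} (hr : 0 < r) (u : E) (hu : ‖u‖ = 1)
    (S : Finset E) (w : E → ℝ) (hw : ∀ v ∈ S, 0 ≤ w v) (hw1 : ∑ v ∈ S, w v = 1)
    (hw0 : ∑ v ∈ S, w v • v = 0) (hS : ∀ v ∈ S, ‖v‖ = 1)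
    (hSK : ∀ v ∈ S, ∀ x ∈ K, ⟪v, x⟫ ≤ r) :
    μ K ≤ μ {x | |⟪u, x⟫| ≤ r} := by
  have : Nontrivial E := Module.nontrivial_of_finrank_pos (R := ℝ) (by omega)
  set T : Set E := {x | |⟪u, x⟫| ≤ r} with hT
  have hTm : MeasurableSet T := (isClosed_le (by fun_prop) (by fun_prop)).measurableSet
  by_cases hfin : μ T = ⊤
  · rw [hfin]; exact le_top
  have hloc : IsLocallyFiniteMeasure μ := by
    refine ⟨fun x => ?_⟩
    obtain ⟨v, hv1, hvx⟩ : ∃ v : E, ‖v‖ = 1 ∧ ⟪v, x⟫ = 0 := by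
      have h1 := Submodule.finrank_add_finrank_orthogonal (Submodule.span ℝ {x})
      have h2 : Module.finrank ℝ (Submodule.span ℝ {x}) ≤ 1 := (finrank_span_le_card {x}).trans (by simp)
      have : Nontrivial (Submodule.span ℝ {x})ᗮ :=
        Module.nontrivial_of_finrank_pos (R := ℝ) (by omega)
      obtain ⟨y, hy⟩ := exists_norm_eq (Submodule.span ℝ {x})ᗮ (zero_le_one' ℝ)
      exact ⟨y, by simpa using hy, Submodule.mem_orthogonal_singleton_iff_inner_left.1 y.2⟩
    obtain ⟨O, hO⟩ := exists_rot u v hu hv1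
    have hTv : μ {y | |⟪v, y⟫| ≤ r} = μ T := by
      have hm : MeasurableSet {y : E | |⟪v, y⟫| ≤ r} :=
        (isClosed_le (by fun_prop) (by fun_prop)).measurableSet
      conv_lhs => rw [← hinv O]
      rw [Measure.map_apply O.continuous.measurable hm]
      congr 1
      ext y
      simp only [Set.mem_preimage, Set.mem_ofPred_eq, hT, ← hO, O.inner_map_map]
    refine ⟨{y | |⟪v, y⟫| < r}, ?_, ?_⟩
    · refine (isOpen_lt (by fun_prop) (by fun_prop)).mem_nhds ?_
      simpa [hvx] using hr
    · refine lt_of_le_of_lt (measure_mono fun y hy => ?_) (hTv.trans_lt (lt_top_iff_ne_top.2 hfin))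
      have hy' : |⟪v, y⟫| < r := hy
      exact hy'.le
  obtain ⟨h, hm, hO, hμ⟩ := exists_density μ hac hinv
  have formula : ∀ D : Set E, MeasurableSet D → μ D = ∫⁻ t : Set.Ioi (0 : ℝ),
      h (t.1 • u) * (volume : Measure E).toSphere {ξ | t.1 • ξ.1 ∈ D}
      ∂(Measure.volumeIoiPow (Module.finrank ℝ E - 1)) := by
    intro D hD
    rw [hμ, withDensity_apply _ hD, ← lintegral_indicator hD,
      lintegral_polar _ (hm.indicator hD)]
    refine lintegral_congr fun t => ?_
    have hDt : MeasurableSet {ξ : Metric.sphere (0 : E) 1 | t.1 • ξ.1 ∈ D} :=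
      (by fun_prop : Measurable fun ξ : Metric.sphere (0 : E) 1 => t.1 • ξ.1) hD
    rw [← lintegral_indicator_const hDt]
    refine lintegral_congr fun ξ => ?_
    by_cases hξ : t.1 • ξ.1 ∈ D
    · rw [Set.indicator_of_mem hξ, Set.indicator_of_mem (by exact hξ)]
      obtain ⟨O, hOu⟩ := exists_rot u ξ.1 hu (by simpa using ξ.2)
      rw [← hOu, ← map_smul, hO]
    · rw [Set.indicator_of_notMem hξ, Set.indicator_of_notMem (by exact hξ)]
  rw [formula K hKm, formula T hTm]
  refine lintegral_mono fun t => mul_le_mul' le_rfl ?_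
  have ht : 0 < t.1 := t.2
  refine le_trans (measure_mono ?_) ((sphere_ineq hdim u hu S w hw hw1 hw0 hS
    (div_pos hr ht).le).trans (measure_mono ?_))
  · intro ξ hξ v hv
    have := hSK v hv _ hξ
    rw [real_inner_smul_right] at this
    rwa [le_div_iff₀ ht, mul_comm]
  · intro ξ hξ
    change |⟪u, t.1 • ξ.1⟫| ≤ r
    have hξ' : |⟪u, ξ.1⟫| ≤ r / t.1 := hξ
    rw [real_inner_smul_right, abs_mul, abs_of_pos ht, mul_comm]
    rwa [le_div_iff₀ ht] at hξ'

lemma abs_inner_of_dim_one (hdim : Module.finrank ℝ E = 1) (v : E) (hv : ‖v‖ = 1) (x : E) :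
    |⟪v, x⟫| = ‖x‖ := by
  have hv0 : v ≠ 0 := by rintro rfl; simp at hv
  obtain ⟨c, rfl⟩ := (finrank_eq_one_iff_of_nonzero' v hv0).1 hdim x
  rw [real_inner_smul_right, real_inner_self_eq_norm_sq, hv, norm_smul, hv]
  simp

end Radial

theorem measure_convex_le_measure_plank (n : ℕ)
    (μ : Measure (EuclideanSpace ℝ (Fin n)))
    (hac : μ ≪ volume)
    (hinv : ∀ O : EuclideanSpace ℝ (Fin n) ≃ₗᵢ[ℝ] EuclideanSpace ℝ (Fin n),
      Measure.map O μ = μ)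
    (K : Set (EuclideanSpace ℝ (Fin n)))
    (hKconv : Convex ℝ K) (hKcomp : IsCompact K) (hKint : (interior K).Nonempty)
    (r : ℝ) (hr : 0 < r)
    (hball : Metric.closedBall 0 r ⊆ K)
    (hmax : ∀ (c : EuclideanSpace ℝ (Fin n)) (R : ℝ), Metric.closedBall c R ⊆ K → R ≤ r)
    (u : EuclideanSpace ℝ (Fin n)) (hu : ‖u‖ = 1) :
    μ K ≤ μ {x | |⟪u, x⟫| ≤ r} := by
  obtain ⟨S, w, hw, hw1, hw0, hS⟩ := contacts hKconv hKcomp hr hball hmax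
  have hfr : Module.finrank ℝ (EuclideanSpace ℝ (Fin n)) = n := finrank_euclideanSpace_fin
  rcases Nat.lt_or_ge 1 n with hn | hn
  · exact main_ge_two (hfr.symm ▸ hn) μ hac hinv K hKcomp.isClosed.measurableSet hr u hu S w hw hw1
      hw0 (fun v hv => (hS v hv).1) (fun v hv => (hS v hv).2)
  have hn1 : n = 1 := by
    rcases Nat.eq_zero_or_pos n with rfl | h
    · rw [Subsingleton.elim u 0] at hu
      simp at hu
    · omega
  have hd : Module.finrank ℝ (EuclideanSpace ℝ (Fin n)) = 1 := hfr.trans hn1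
  refine measure_mono fun x hx => ?_
  change |⟪u, x⟫| ≤ r
  rw [abs_inner_of_dim_one hd u hu]
  by_contra hlt
  rw [not_le] at hlt
  have hall : ∀ v ∈ S, ⟪v, x⟫ = -‖x‖ := by
    intro v hv
    have h1 := abs_inner_of_dim_one hd v (hS v hv).1 x
    have h2 := (hS v hv).2 x hx
    rcases abs_choice ⟪v, x⟫ with h | h <;> linarith
  have h1 : ∑ z ∈ S, w z * ⟪z, x⟫ = 0 := by
    have : ⟪∑ z ∈ S, w z • z, x⟫ = 0 := by rw [hw0, inner_zero_left]
    rw [sum_inner] at this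
    simpa only [real_inner_smul_left] using this
  rw [Finset.sum_congr rfl (fun z hz => by rw [hall z hz]), ← Finset.sum_mul, hw1] at h1
  linarith
end

section
/- Let K be a convex body in ℝⁿ whose inscribed ball is B(0, r), let S be the sphere of radius R > r centered at the origin, and let T = {x : |⟨u, x⟩| ≤ r} be a plank with inscribed ball B(0, r). Then σ(K ∩ S) ≤ σ(T ∩ S), where σ is the surface measure on S. -/
open MeasureTheory RealInnerProductSpace
open scoped ENNReal

lemma hull_compact {E : Type*} [NormedAddCommGroup E] [InnerProductSpace ℝ E]
    [FiniteDimensional ℝ E] {N : Set E} (hN : IsCompact N) : IsCompact (convexHull ℝ N) := by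
  have key : convexHull ℝ N = ⋃ k ∈ Set.Iic (Module.finrank ℝ E + 1),
      (fun p : (Fin k → ℝ) × (Fin k → E) => ∑ i, p.1 i • p.2 i) ''
        ((stdSimplex ℝ (Fin k)) ×ˢ (Set.univ.pi fun _ => N)) := by
    apply Set.Subset.antisymm
    · intro x hx
      obtain ⟨ι, _, z, w, hz, hai, hw, hw1, hx⟩ := eq_pos_convex_span_of_mem_convexHull hx
      have hc : Fintype.card ι ≤ Module.finrank ℝ E + 1 := by
        refine hai.card_le_finrank_succ.trans ?_
        gcongr
        exact Submodule.finrank_le _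
      let e := Fintype.equivFin ι
      simp only [Set.mem_iUnion]
      refine ⟨Fintype.card ι, hc, ⟨fun i => w (e.symm i), fun i => z (e.symm i)⟩, ⟨⟨?_, ?_⟩, ?_⟩, ?_⟩
      · intro i; exact (hw _).le
      · simpa using (e.symm.sum_comp w).trans hw1
      · intro i _; exact hz ⟨_, rfl⟩
      · simpa using (e.symm.sum_comp (fun i => w i • z i)).trans hx
    · intro x hx
      simp only [Set.mem_iUnion] at hx
      obtain ⟨k, -, ⟨w, z⟩, ⟨⟨h1, h2⟩, h3⟩, rfl⟩ := hx
      exact (convex_convexHull ℝ N).sum_mem (fun i _ => h1 i) h2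
        (fun i _ => subset_convexHull ℝ N (h3 i (Set.mem_univ i)))
  rw [key]
  refine (Set.finite_Iic _).isCompact_biUnion fun k _ => ?_
  refine ((isCompact_stdSimplex ℝ (Fin k)).prod (isCompact_univ_pi fun _ => hN)).image ?_
  fun_prop

/-- averaging over the stabilizer of `u` -/
lemma exists_avg {E : Type*} [NormedAddCommGroup E] [InnerProductSpace ℝ E]
    [FiniteDimensional ℝ E] [MeasurableSpace E] [BorelSpace E] (u : E)
    (σ : Measure E) [IsFiniteMeasure σ] (hinv : ∀ φ : E ≃ₗᵢ[ℝ] E, MeasurePreserving φ σ σ)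
    (V : Set E) (hV : MeasurableSet V) :
    ∃ g : E → ℝ≥0∞,
      (∀ A : Set E, MeasurableSet A → (∀ φ : E ≃ₗᵢ[ℝ] E, φ u = u → ∀ x, φ x ∈ A ↔ x ∈ A) →
        σ (V ∩ A) = ∫⁻ x in A, g x ∂σ) ∧
      (∀ (φ : E ≃ₗᵢ[ℝ] E) (x : E), φ u = u → g (φ x) = g x) ∧
      (∀ x y : E, (∀ φ : E ≃ₗᵢ[ℝ] E, φ u = u → φ y ∈ V → φ x ∈ V) → g y ≤ g x) := by
  have : CompleteSpace E := FiniteDimensional.complete ℝ E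
  have : ProperSpace (E →L[ℝ] E) := FiniteDimensional.proper ℝ _
  have : SecondCountableTopology (E →L[ℝ] E) := secondCountable_of_proper
  have : SecondCountableTopology E := by
    have := FiniteDimensional.proper ℝ E
    exact secondCountable_of_proper
  let G := unitary (E →L[ℝ] E)
  let L := Unitary.linearIsometryEquiv (𝕜 := ℝ) (H := E)
  let H : Subgroup G :=
    { carrier := {k | L k u = u}
      mul_mem' := by
        intro a b ha hb
        simp only [Set.mem_ofPred_eq, map_mul, LinearIsometryEquiv.coe_mul, Function.comp] at *
        rw [hb, ha]
      one_mem' := by simp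
      inv_mem' := by
        intro a ha
        simp only [Set.mem_ofPred_eq, map_inv] at *
        change (L a).symm u = u
        rw [LinearIsometryEquiv.symm_apply_eq, ha] }
  have hGc : IsCompact ((unitary (E →L[ℝ] E) : Submonoid _) : Set (E →L[ℝ] E)) := by
    refine Metric.isCompact_of_isClosed_isBounded isClosed_unitary ?_
    refine (Metric.isBounded_closedBall (x := (0 : E →L[ℝ] E)) (r := 1)).subset ?_
    intro k hk
    rw [mem_closedBall_zero_iff]
    refine ContinuousLinearMap.opNorm_le_bound _ zero_le_one fun x => ?_
    rw [one_mul]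
    exact ((L ⟨k, hk⟩).norm_map x).le
  have : CompactSpace G := isCompact_iff_compactSpace.mp hGc
  have hcont : Continuous fun p : G × E => L p.1 p.2 := by
    change Continuous fun p : G × E => (p.1 : E →L[ℝ] E) p.2
    fun_prop
  have hHcl : IsClosed (H : Set G) := by
    change IsClosed {k : G | L k u = u}
    exact isClosed_eq (hcont.comp (by fun_prop : Continuous fun k : G => (k, u))) continuous_const
  have : CompactSpace H := isCompact_iff_compactSpace.mp hHcl.isCompact
  have : SecondCountableTopology G := inferInstanceAs (SecondCountableTopology (Subtype _))
  have : SecondCountableTopology H := inferInstanceAs (SecondCountableTopology (Subtype _))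
  let : MeasurableSpace H := borel H
  have : BorelSpace H := ⟨rfl⟩
  let m : Measure H := Measure.haarMeasure ⊤
  have hm : m Set.univ = 1 := by
    have := Measure.haarMeasure_self (K₀ := (⊤ : TopologicalSpace.PositiveCompacts H))
    simpa using this
  have : IsProbabilityMeasure m := ⟨hm⟩
  let S : Set (H × E) := {p | L (p.1⁻¹ : H) p.2 ∈ V}
  have hc2 : Continuous fun p : H × E => L ((p.1⁻¹ : H) : G) p.2 :=
    hcont.comp (by fun_prop : Continuous fun p : H × E => (((p.1⁻¹ : H) : G), p.2))
  have hS : MeasurableSet S := hc2.measurable hV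
  refine ⟨fun x => m {k | L ((k⁻¹ : H) : G) x ∈ V}, ?_, ?_, ?_⟩
  · intro A hA hAi
    have e1 : (m.prod (σ.restrict A)) S = ∫⁻ x in A, m {k | L ((k⁻¹ : H) : G) x ∈ V} ∂σ :=
      Measure.prod_apply_symm hS
    rw [← e1, Measure.prod_apply hS]
    have e2 : ∀ k : H, (σ.restrict A) (Prod.mk k ⁻¹' S) = σ (V ∩ A) := by
      intro k
      rw [Measure.restrict_apply (measurable_prodMk_left hS)]
      have : Prod.mk k ⁻¹' S ∩ A = L ((k⁻¹ : H) : G) ⁻¹' (V ∩ A) := by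
        ext x
        have := hAi (L ((k⁻¹ : H) : G)) (k⁻¹).2 x
        simp only [Set.mem_inter_iff, Set.mem_preimage, this]
        rfl
      rw [this, (hinv _).measure_preimage (hV.inter hA).nullMeasurableSet]
    simp [e2]
  · intro φ x hφ
    let k0 : H := ⟨L.symm φ, by change L (L.symm φ) u = u; simpa using hφ⟩
    have : {k : H | L ((k⁻¹ : H) : G) (φ x) ∈ V} =
        (fun k => k0⁻¹ * k) ⁻¹' {k : H | L ((k⁻¹ : H) : G) x ∈ V} := by
      ext k
      have hk : L (((k0⁻¹ * k)⁻¹ : H) : G) x = L ((k⁻¹ : H) : G) (φ x) := by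
        simp [k0]
      simp only [Set.mem_preimage, Set.mem_ofPred_eq, hk]
    simp only [this]
    exact measure_preimage_mul m _ _
  · intro x y h
    exact measure_mono fun k hk => h _ (k⁻¹).2 hk

lemma exists_refl {E : Type*} [NormedAddCommGroup E] [InnerProductSpace ℝ E]
    [FiniteDimensional ℝ E] (x y : E) (h : ‖x‖ = ‖y‖) :
    ∃ φ : E ≃ₗᵢ[ℝ] E, φ x = y ∧ ∀ w : E, ⟪w, x⟫ = ⟪w, y⟫ → φ w = w := by
  refine ⟨(ℝ ∙ (x - y))ᗮ.reflection, Submodule.reflection_sub h, fun w hw => ?_⟩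
  apply Submodule.reflection_mem_subspace_eq_self
  rw [Submodule.mem_orthogonal_singleton_iff_inner_left, inner_sub_right, hw, sub_self]

lemma cone_ineq {E : Type*} [NormedAddCommGroup E] [InnerProductSpace ℝ E]
    [FiniteDimensional ℝ E] [MeasurableSpace E] [BorelSpace E] (u : E) (hu : ‖u‖ = 1)
    (σ : Measure E) [IsFiniteMeasure σ] (hinv : ∀ φ : E ≃ₗᵢ[ℝ] E, MeasurePreserving φ σ σ)
    (V : Set E) (hV : MeasurableSet V)
    (hstar : ∀ y ∈ V, ∀ a b : ℝ, 0 ≤ a → 0 ≤ b → (0 < a ∨ 0 < b) → a • u + b • y ∈ V)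
    (r R : ℝ) (hr : 0 < r) (hR : r < R) :
    σ (V ∩ ({x | 0 < ⟪u, x⟫ ∧ ⟪u, x⟫ ≤ r} ∩ Metric.sphere 0 R)) *
        σ ({x | r < ⟪u, x⟫} ∩ Metric.sphere 0 R) ≤
      σ (V ∩ ({x | r < ⟪u, x⟫} ∩ Metric.sphere 0 R)) *
        σ ({x | 0 < ⟪u, x⟫ ∧ ⟪u, x⟫ ≤ r} ∩ Metric.sphere 0 R) := by
  obtain ⟨g, g1, g2, g3⟩ := exists_avg u σ hinv V hV
  have hinner : ∀ φ : E ≃ₗᵢ[ℝ] E, φ u = u → ∀ x, ⟪u, φ x⟫ = ⟪u, x⟫ := by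
    intro φ hφ x
    conv_lhs => rw [← hφ]
    exact φ.inner_map_map u x
  have hc : Continuous fun x : E => ⟪u, x⟫ := by fun_prop
  have hSm : MeasurableSet (Metric.sphere (0 : E) R) := Metric.isClosed_sphere.measurableSet
  set A := {x : E | r < ⟪u, x⟫} ∩ Metric.sphere 0 R with hAdef
  set B := {x : E | 0 < ⟪u, x⟫ ∧ ⟪u, x⟫ ≤ r} ∩ Metric.sphere 0 R with hBdef
  have hA : MeasurableSet A := (measurableSet_lt measurable_const hc.measurable).inter hSm
  have hB : MeasurableSet B :=
    ((measurableSet_lt measurable_const hc.measurable).inter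
      (measurableSet_le hc.measurable measurable_const)).inter hSm
  rw [g1 A hA (fun φ hφ x => by simp [hAdef, hinner φ hφ]),
    g1 B hB (fun φ hφ x => by simp [hBdef, hinner φ hφ])]
  have key : ∀ x ∈ A, ∀ y ∈ B, g y ≤ g x := by
    rintro x ⟨hx1, hx2⟩ y ⟨⟨hy0, hy1⟩, hy2⟩
    rw [mem_sphere_zero_iff_norm] at hx2 hy2
    simp only [Set.mem_ofPred_eq] at hx1 hy0 hy1
    have hxR : ⟪u, x⟫ ≤ R := by
      have := real_inner_le_norm u x
      rwa [hu, hx2, one_mul] at this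
    set s := ⟪u, x⟫ with hs
    set t := ⟪u, y⟫ with ht
    have hd : 0 < R ^ 2 - t ^ 2 := by nlinarith
    set b := √((R ^ 2 - s ^ 2) / (R ^ 2 - t ^ 2)) with hb
    have hb0 : 0 ≤ b := Real.sqrt_nonneg _
    have hnn : 0 ≤ R ^ 2 - s ^ 2 := by nlinarith
    have hb2 : b ^ 2 * (R ^ 2 - t ^ 2) = R ^ 2 - s ^ 2 := by
      rw [hb, Real.sq_sqrt (div_nonneg hnn hd.le), div_mul_cancel₀ _ hd.ne']
    have hb1 : b ≤ 1 := by
      rw [hb, Real.sqrt_le_left zero_le_one, one_pow, div_le_one hd]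
      nlinarith
    have ha : 0 < s - b * t := by nlinarith
    set y' := (s - b * t) • u + b • y with hy'
    have huy' : ⟪u, y'⟫ = s := by
      rw [hy', inner_add_right, inner_smul_right, inner_smul_right,
        real_inner_self_eq_norm_sq, hu, ← ht]
      ring
    have hny' : ‖y'‖ = R := by
      have h1 : ‖y'‖ ^ 2 = R ^ 2 := by
        rw [hy', norm_add_sq_real, norm_smul, norm_smul, inner_smul_left, inner_smul_right,
          ← ht, hu, hy2, mul_pow, mul_pow, Real.norm_eq_abs, Real.norm_eq_abs, sq_abs, sq_abs]
        simp only [conj_trivial]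
        nlinarith
      have := (sq_eq_sq₀ (norm_nonneg y') (by linarith)).1 h1
      exact this
    obtain ⟨φ, hφ, hφ2⟩ := exists_refl y' x (hny'.trans hx2.symm)
    have hφu : φ u = u := hφ2 u (by rw [huy', hs])
    rw [← hφ, g2 φ y' hφu]
    apply g3
    intro ψ hψ hψy
    rw [hy', map_add, map_smul, map_smul, hψ]
    exact hstar _ hψy _ _ ha.le hb0 (Or.inl ha)
  calc (∫⁻ x in B, g x ∂σ) * σ A = ∫⁻ x in A, (∫⁻ y in B, g y ∂σ) ∂σ := by
        rw [setLIntegral_const]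
    _ ≤ ∫⁻ x in A, g x * σ B ∂σ := by
        refine setLIntegral_mono' hA fun x hx => ?_
        rw [← setLIntegral_const]
        exact setLIntegral_mono' hB fun y hy => key x hx y hy
    _ = (∫⁻ x in A, g x ∂σ) * σ B := lintegral_mul_const' _ _ (measure_ne_top _ _)

lemma inv_inner {E : Type*} [NormedAddCommGroup E] [InnerProductSpace ℝ E]
    [FiniteDimensional ℝ E] [MeasurableSpace E] [BorelSpace E] (u v : E) (h : ‖u‖ = ‖v‖)
    (σ : Measure E) (hinv : ∀ φ : E ≃ₗᵢ[ℝ] E, MeasurePreserving φ σ σ) (D : Set ℝ) :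
    σ ((fun x => ⟪v, x⟫) ⁻¹' D) = σ ((fun x => ⟪u, x⟫) ⁻¹' D) := by
  obtain ⟨φ, hφ, -⟩ := exists_refl u v h
  have h1 := (hinv φ).measure_preimage_emb φ.toHomeomorph.measurableEmbedding
    ((fun x => ⟪v, x⟫) ⁻¹' D)
  rw [← h1]
  congr 1
  ext x
  simp only [Set.mem_preimage, ← hφ, φ.inner_map_map]

lemma finite_case {E : Type*} [NormedAddCommGroup E] [InnerProductSpace ℝ E]
    [FiniteDimensional ℝ E] [MeasurableSpace E] [BorelSpace E] (u : E) (hu : ‖u‖ = 1)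
    (σ : Measure E) [IsFiniteMeasure σ] (hinv : ∀ φ : E ≃ₗᵢ[ℝ] E, MeasurePreserving φ σ σ)
    (r R : ℝ) (hr : 0 < r) (hR : r < R) (hσ : σ (Metric.sphere 0 R)ᶜ = 0)
    (k : ℕ) (i0 : Fin k) (v : Fin k → E) (hv : ∀ i, ‖v i‖ = 1)
    (hpos : ∀ x, (∀ i, ⟪v i, x⟫ ≤ 0) → ∀ i, ⟪v i, x⟫ = 0)
    (K : Set E) (hKm : MeasurableSet K) (hK : ∀ x ∈ K, ∀ i, ⟪v i, x⟫ ≤ r) :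
    σ K ≤ σ ((fun x => ⟪u, x⟫) ⁻¹' {t | |t| ≤ r}) := by
  have hm : ∀ w : E, Measurable fun x : E => ⟪w, x⟫ := fun w =>
    (by fun_prop : Continuous fun x : E => ⟪w, x⟫).measurable
  set V : Fin k → Set E := fun i =>
    {x | ∀ j, (j < i → ⟪v j, x⟫ < ⟪v i, x⟫) ∧ ⟪v j, x⟫ ≤ ⟪v i, x⟫} with hVdef
  have hVm : ∀ i, MeasurableSet (V i) := by
    intro i
    simp only [hVdef, Set.ofPred_forall, Set.ofPred_and]
    refine MeasurableSet.iInter fun j => MeasurableSet.inter ?_ ?_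
    · exact MeasurableSet.iInter fun _ => measurableSet_lt (hm _) (hm _)
    · exact measurableSet_le (hm _) (hm _)
  have hcover : ∀ x, ∃ i, x ∈ V i := by
    intro x
    have hne : (Finset.univ.filter fun i : Fin k => ∀ j, ⟪v j, x⟫ ≤ ⟪v i, x⟫).Nonempty := by
      obtain ⟨i, -, hi⟩ := Finset.exists_max_image Finset.univ (fun i => ⟪v i, x⟫)
        ⟨i0, Finset.mem_univ _⟩
      exact ⟨i, by simpa using hi⟩
    set F := Finset.univ.filter fun i : Fin k => ∀ j, ⟪v j, x⟫ ≤ ⟪v i, x⟫ with hF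
    have hmem := (Finset.mem_filter (p := fun i : Fin k => ∀ j, ⟪v j, x⟫ ≤ ⟪v i, x⟫)).1
      (F.min'_mem hne)
    refine ⟨F.min' hne, fun j => ⟨fun hj => ?_, hmem.2 j⟩⟩
    by_contra hcon
    push Not at hcon
    have : j ∈ F := by
      rw [hF, Finset.mem_filter]
      exact ⟨Finset.mem_univ _, fun l => (hmem.2 l).trans hcon⟩
    exact absurd (F.min'_le j this) (not_le.2 hj)
  have hdisj : Pairwise (Function.onFun Disjoint V) := by
    intro i j hij
    rw [Function.onFun, Set.disjoint_left]
    intro x hxi hxj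
    rcases lt_or_gt_of_ne hij with h | h
    · exact absurd ((hxj i).1 h) (not_lt.2 (hxi j).2)
    · exact absurd ((hxi j).1 h) (not_lt.2 (hxj i).2)
  have hstar : ∀ i, ∀ y ∈ V i, ∀ a b : ℝ, 0 ≤ a → 0 ≤ b → (0 < a ∨ 0 < b) →
      a • v i + b • y ∈ V i := by
    intro i y hy a b ha hb hab j
    have e1 : ⟪v i, v i⟫ = 1 := by rw [real_inner_self_eq_norm_sq, hv]; norm_num
    have e2 : ⟪v j, v i⟫ ≤ 1 := by
      have := real_inner_le_norm (v j) (v i)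
      simpa [hv] using this
    simp only [inner_add_right, inner_smul_right, e1]
    obtain ⟨h1, h2⟩ := hy j
    refine ⟨fun hj => ?_, by nlinarith⟩
    have h3 := h1 hj
    have e3 : ⟪v j, v i⟫ < 1 := by
      refine lt_of_le_of_ne e2 fun h => ?_
      have := (inner_eq_one_iff_of_norm_eq_one (hv j) (hv i)).1 h
      rw [this] at h3
      exact lt_irrefl _ h3
    rcases hab with h | h <;> nlinarith
  -- quantities
  set a := σ.real ((fun x => ⟪u, x⟫) ⁻¹' {t | r < t}) with ha
  set b := σ.real ((fun x => ⟪u, x⟫) ⁻¹' {t | 0 < t ∧ t ≤ r}) with hb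
  set e := σ.real ((fun x => ⟪u, x⟫) ⁻¹' {t | t = 0}) with he
  set T := σ.real ((fun x => ⟪u, x⟫) ⁻¹' {t | |t| ≤ r}) with hT
  set p : Fin k → ℝ := fun i => σ.real (V i ∩ (fun x => ⟪v i, x⟫) ⁻¹' {t | r < t}) with hp
  set q : Fin k → ℝ := fun i =>
    σ.real (V i ∩ (fun x => ⟪v i, x⟫) ⁻¹' {t | 0 < t ∧ t ≤ r}) with hq
  have hS : ∀ X : Set E, σ (X ∩ Metric.sphere 0 R) = σ X := fun X => measure_inter_conull hσ
  have huv : ∀ w : E, ‖w‖ = 1 → ∀ D : Set ℝ,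
      σ.real ((fun x => ⟪w, x⟫) ⁻¹' D) = σ.real ((fun x => ⟪u, x⟫) ⁻¹' D) := by
    intro w hw D
    simp only [measureReal_def]
    rw [inv_inner u w (hu.trans hw.symm) σ hinv D]
  have hqp : ∀ i, q i * a ≤ p i * b := by
    intro i
    have h1 := cone_ineq (v i) (hv i) σ hinv (V i) (hVm i) (hstar i) r R hr hR
    simp only [← Set.inter_assoc, hS] at h1
    have h2 := ENNReal.toReal_mono (ENNReal.mul_ne_top (measure_ne_top _ _) (measure_ne_top _ _)) h1
    rw [ENNReal.toReal_mul, ENNReal.toReal_mul] at h2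
    rw [ha, hb, ← huv (v i) (hv i), ← huv (v i) (hv i)]
    exact h2
  have hmeas1 : MeasurableSet {t : ℝ | r < t} := measurableSet_Ioi
  have hmeas2 : MeasurableSet {t : ℝ | 0 < t ∧ t ≤ r} := measurableSet_Ioc
  have hneg : ∀ D : Set ℝ, σ.real ((fun x => ⟪u, x⟫) ⁻¹' {t | -t ∈ D}) =
      σ.real ((fun x => ⟪u, x⟫) ⁻¹' D) := by
    intro D
    rw [← huv (-u) (by rw [norm_neg, hu]) D]
    congr 1
    ext x
    simp
  -- total mass
  have htot : σ.real Set.univ = T + 2 * a := by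
    have h1 := measureReal_add_measureReal_compl (μ := σ)
      (s := (fun x => ⟪u, x⟫) ⁻¹' {t | |t| ≤ r})
      (hm u (measurableSet_le measurable_norm measurable_const))
    have h2 : ((fun x => ⟪u, x⟫) ⁻¹' {t : ℝ | |t| ≤ r})ᶜ =
        (fun x => ⟪u, x⟫) ⁻¹' {t | r < t} ∪ (fun x => ⟪u, x⟫) ⁻¹' {t | -t ∈ {t | r < t}} := by
      ext x
      simp [lt_abs]
    have hmn : MeasurableSet ((fun x => ⟪u, x⟫) ⁻¹' {t | -t ∈ {t | r < t}}) :=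
      hm u (measurable_neg hmeas1)
    rw [h2, measureReal_union _ hmn, hneg] at h1
    · linarith
    · rw [Set.disjoint_left]
      intro x h3 h4
      simp only [Set.mem_preimage, Set.mem_ofPred_eq] at h3 h4
      linarith
  have hTb : T = 2 * b + e := by
    have h2 : ((fun x => ⟪u, x⟫) ⁻¹' {t : ℝ | |t| ≤ r}) =
        ((fun x => ⟪u, x⟫) ⁻¹' {t | t = 0}) ∪
        ((fun x => ⟪u, x⟫) ⁻¹' {t | 0 < t ∧ t ≤ r} ∪
          (fun x => ⟪u, x⟫) ⁻¹' {t | -t ∈ {t | 0 < t ∧ t ≤ r}}) := by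
      ext x
      simp only [Set.mem_preimage, Set.mem_ofPred_eq, Set.mem_union, abs_le]
      constructor
      · rintro ⟨h3, h4⟩
        rcases lt_trichotomy ⟪u, x⟫ 0 with h | h | h
        · exact Or.inr (Or.inr ⟨by linarith, by linarith⟩)
        · exact Or.inl h
        · exact Or.inr (Or.inl ⟨h, h4⟩)
      · rintro (h | h | h) <;> constructor <;> linarith
    rw [hT, h2, measureReal_union, measureReal_union, hneg]
    · ring
    · rw [Set.disjoint_left]
      intro x h3 h4
      simp only [Set.mem_preimage, Set.mem_ofPred_eq] at h3 h4
      linarith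
    · exact hm u (measurable_neg hmeas2)
    · rw [Set.disjoint_left]
      intro x h3 h4
      simp only [Set.mem_preimage, Set.mem_ofPred_eq, Set.mem_union] at h3 h4
      rcases h4 with h4 | h4 <;> linarith
    · exact (hm u hmeas2).union (hm u (measurable_neg hmeas2))
  have hlow : σ.real Set.univ ≤ ∑ i, p i + ∑ i, q i + e := by
    have hsub : (Set.univ : Set E) ⊆
        ((⋃ i, V i ∩ (fun x => ⟪v i, x⟫) ⁻¹' {t | r < t}) ∪
        (⋃ i, V i ∩ (fun x => ⟪v i, x⟫) ⁻¹' {t | 0 < t ∧ t ≤ r})) ∪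
        ((fun x => ⟪v i0, x⟫) ⁻¹' {t | t = 0}) := by
      intro x _
      obtain ⟨i, hi⟩ := hcover x
      rcases le_or_gt ⟪v i, x⟫ 0 with h | h
      · right
        exact hpos x (fun j => ((hi j).2).trans h) i0
      · left
        rcases le_or_gt ⟪v i, x⟫ r with h' | h'
        · right; exact Set.mem_iUnion.2 ⟨i, hi, h, h'⟩
        · left; exact Set.mem_iUnion.2 ⟨i, hi, h'⟩
    refine (measureReal_mono hsub).trans ?_
    refine (measureReal_union_le _ _).trans ?_
    rw [huv (v i0) (hv i0)]
    refine add_le_add ((measureReal_union_le _ _).trans (add_le_add ?_ ?_)) le_rfl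
    · exact measureReal_iUnion_fintype_le _
    · exact measureReal_iUnion_fintype_le _
  have hup : ∑ i, p i + σ.real K ≤ σ.real Set.univ := by
    have hdis : Pairwise (Function.onFun Disjoint
        fun i => V i ∩ (fun x => ⟪v i, x⟫) ⁻¹' {t | r < t}) := fun i j hij =>
      (hdisj hij).mono Set.inter_subset_left Set.inter_subset_left
    have h1 : ∑ i, p i = σ.real (⋃ i, V i ∩ (fun x => ⟪v i, x⟫) ⁻¹' {t | r < t}) := by
      rw [measureReal_iUnion_fintype hdis fun i => (hVm i).inter (hm _ hmeas1)]
    rw [h1, ← measureReal_union _ hKm]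
    · exact measureReal_mono (Set.subset_univ _)
    · rw [Set.disjoint_left]
      intro x hx hxK
      obtain ⟨i, -, hi⟩ := Set.mem_iUnion.1 hx
      exact absurd (hK x hxK i) (not_le.2 hi)
  have hsum : (∑ i, q i) * a ≤ (∑ i, p i) * b := by
    rw [Finset.sum_mul, Finset.sum_mul]
    exact Finset.sum_le_sum fun i _ => hqp i
  have ha0 : 0 ≤ a := measureReal_nonneg
  have hb0 : 0 ≤ b := measureReal_nonneg
  have hP0 : 0 ≤ ∑ i, p i := Finset.sum_nonneg fun i _ => measureReal_nonneg
  have hfin : 2 * a ≤ ∑ i, p i := by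
    rcases ha0.eq_or_lt with h | h
    · rw [← h]; linarith
    · have : 2 * a * (a + b) ≤ (∑ i, p i) * (a + b) := by nlinarith
      exact le_of_mul_le_mul_right this (by linarith)
  have hres : σ.real K ≤ T := by linarith
  exact (ENNReal.toReal_le_toReal (measure_ne_top _ _) (measure_ne_top _ _)).1 hres

lemma exists_normal {E : Type*} [NormedAddCommGroup E] [InnerProductSpace ℝ E]
    [FiniteDimensional ℝ E] (K : Set E) (hKconv : Convex ℝ K) (hKcomp : IsCompact K)
    (r : ℝ) (hr : 0 < r) (hball : Metric.closedBall 0 r ⊆ K)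
    (hmax : ∀ (c : E) (R : ℝ), Metric.closedBall c R ⊆ K → R ≤ r) (w : E) :
    ∃ v : E, ‖v‖ = 1 ∧ (∀ x ∈ K, ⟪v, x⟫ ≤ r) ∧ 0 ≤ ⟪v, w⟫ := by
  have : ProperSpace E := FiniteDimensional.proper ℝ E
  have : CompleteSpace E := FiniteDimensional.complete ℝ E
  have step : ∀ k : ℕ, ∃ v : E, ‖v‖ = 1 ∧ ∀ x ∈ K,
      ⟪v, x⟫ ≤ (1 / ((k : ℝ) + 1)) * ⟪v, w⟫ + r + (1 / ((k : ℝ) + 1)) ^ 2 := by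
    intro k
    set ε : ℝ := 1 / ((k : ℝ) + 1) with hε
    have hε0 : 0 < ε := by positivity
    have hn : ¬ Metric.closedBall (ε • w) (r + ε ^ 2) ⊆ K := by
      intro h
      have := hmax _ _ h
      nlinarith [pow_pos hε0 2]
    obtain ⟨p, hp, hpK⟩ := Set.not_subset.1 hn
    obtain ⟨f, s, hfs, hsp⟩ := geometric_hahn_banach_closed_point hKconv hKcomp.isClosed hpK
    obtain ⟨z, rfl⟩ := (InnerProductSpace.toDual ℝ E).surjective f
    simp only [InnerProductSpace.toDual_apply_apply] at hfs hsp
    have h0 := hfs 0 (hball (by simp [hr.le]))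
    have hz : z ≠ 0 := by
      rintro rfl
      simp at h0 hsp
      linarith
    have hzn : 0 < ‖z‖ := norm_pos_iff.2 hz
    have hv1 : ‖(‖z‖⁻¹ : ℝ) • z‖ = 1 := by
      rw [norm_smul, norm_inv, norm_norm, inv_mul_cancel₀ hzn.ne']
    refine ⟨(‖z‖⁻¹ : ℝ) • z, hv1, fun x hx => ?_⟩
    have h1 : ⟪(‖z‖⁻¹ : ℝ) • z, x⟫ ≤ ⟪(‖z‖⁻¹ : ℝ) • z, p⟫ := by
      rw [real_inner_smul_left, real_inner_smul_left]
      have := (hfs x hx).trans hsp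
      gcongr
    have h2 := real_inner_le_norm ((‖z‖⁻¹ : ℝ) • z) (p - ε • w)
    rw [hv1, one_mul, inner_sub_right, inner_smul_right] at h2
    rw [mem_closedBall_iff_norm] at hp
    linarith
  choose v hv1 hv2 using step
  obtain ⟨v0, hv0, φ, hφ, hlim⟩ := (isCompact_sphere (0 : E) 1).tendsto_subseq
    (x := v) (fun k => by simpa using hv1 k)
  have hε : Filter.Tendsto (fun k : ℕ => 1 / ((φ k : ℝ) + 1)) Filter.atTop (nhds 0) :=
    (tendsto_one_div_add_atTop_nhds_zero_nat (𝕜 := ℝ)).comp hφ.tendsto_atTop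
  have hin : ∀ x : E, Filter.Tendsto (fun k => ⟪v (φ k), x⟫) Filter.atTop (nhds ⟪v0, x⟫) :=
    fun x => hlim.inner tendsto_const_nhds
  refine ⟨v0, by simpa using hv0, fun x hx => ?_, ?_⟩
  · have h3 : Filter.Tendsto (fun k : ℕ => (1 / ((φ k : ℝ) + 1)) * ⟪v (φ k), w⟫ + r
        + (1 / ((φ k : ℝ) + 1)) ^ 2) Filter.atTop (nhds (0 * ⟪v0, w⟫ + r + 0 ^ 2)) :=
      ((hε.mul (hin w)).add_const r).add (hε.pow 2)
    have := le_of_tendsto_of_tendsto' (hin x) h3 fun k => hv2 (φ k) x hx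
    linarith
  · have h4 : ∀ k, -(1 / ((φ k : ℝ) + 1)) ≤ ⟪v (φ k), w⟫ := by
      intro k
      have h5 := hv2 (φ k) (r • v (φ k)) (hball (by
        rw [mem_closedBall_zero_iff, norm_smul, hv1, mul_one, Real.norm_of_nonneg hr.le]))
      rw [inner_smul_right, real_inner_self_eq_norm_sq, hv1] at h5
      have hε0 : 0 < 1 / ((φ k : ℝ) + 1) := by positivity
      by_contra hcon
      push Not at hcon
      nlinarith
    have := le_of_tendsto_of_tendsto' hε.neg (hin w) h4
    linarith

lemma exists_family {E : Type*} [NormedAddCommGroup E] [InnerProductSpace ℝ E]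
    [FiniteDimensional ℝ E] (K : Set E) (hKconv : Convex ℝ K) (hKcomp : IsCompact K)
    (r : ℝ) (hr : 0 < r) (hball : Metric.closedBall 0 r ⊆ K)
    (hmax : ∀ (c : E) (R : ℝ), Metric.closedBall c R ⊆ K → R ≤ r) :
    ∃ (k : ℕ) (_ : Fin k) (v : Fin k → E), (∀ i, ‖v i‖ = 1) ∧ 
      (∀ x, (∀ i, ⟪v i, x⟫ ≤ 0) → ∀ i, ⟪v i, x⟫ = 0) ∧ (∀ x ∈ K, ∀ i, ⟪v i, x⟫ ≤ r) := by
  have : ProperSpace E := FiniteDimensional.proper ℝ E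
  have : CompleteSpace E := FiniteDimensional.complete ℝ E
  set N : Set E := Metric.sphere 0 1 ∩ ⋂ x ∈ K, {v | ⟪v, x⟫ ≤ r} with hN
  have hNc : IsCompact N := by
    refine (isCompact_sphere _ _).inter_right (isClosed_biInter fun x _ => ?_)
    exact isClosed_le (by fun_prop) continuous_const
  have h0 : (0 : E) ∈ convexHull ℝ N := by
    by_contra hcon
    obtain ⟨f, s, hs, hb⟩ := geometric_hahn_banach_point_closed (convex_convexHull ℝ N)
      (hull_compact hNc).isClosed hcon
    obtain ⟨z, rfl⟩ := (InnerProductSpace.toDual ℝ E).surjective f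
    simp only [InnerProductSpace.toDual_apply_apply, inner_zero_right] at hs hb
    obtain ⟨v, hv1, hv2, hv3⟩ := exists_normal K hKconv hKcomp r hr hball hmax (-z)
    have := hb v (subset_convexHull ℝ N ⟨by simpa using hv1, by simpa using hv2⟩)
    rw [inner_neg_right, real_inner_comm] at hv3
    linarith
  obtain ⟨ι, _, z, w, hz, -, hw, hw1, hx⟩ := eq_pos_convex_span_of_mem_convexHull h0
  let e := Fintype.equivFin ι
  have hne : Nonempty ι := by
    by_contra h
    rw [not_nonempty_iff] at h
    simp at hw1
  have hzN : ∀ i, z i ∈ N := fun i => hz ⟨i, rfl⟩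
  refine ⟨Fintype.card ι, e hne.some, fun i => z (e.symm i), fun i => ?_, fun x hx0 => ?_, 
    fun x hxK i => ?_⟩
  · simpa using (hzN (e.symm i)).1
  · have h1 : ∑ i, w i * ⟪z i, x⟫ = 0 := by
      have := congrArg (fun y => ⟪y, x⟫) hx
      simpa [sum_inner, real_inner_smul_left] using this
    have h2 : ∀ i, ⟪z i, x⟫ ≤ 0 := fun i => by simpa using hx0 (e i)
    have h3 := (Finset.sum_eq_zero_iff_of_nonpos fun i _ =>
      mul_nonpos_of_nonneg_of_nonpos (hw i).le (h2 i)).1 h1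
    intro i
    exact (mul_eq_zero.1 (h3 (e.symm i) (Finset.mem_univ _))).resolve_left (hw _).ne'
  · have := (hzN (e.symm i)).2
    simp only [Set.mem_iInter] at this
    exact this x hxK

lemma finite_of_plank {E : Type*} [NormedAddCommGroup E] [InnerProductSpace ℝ E]
    [FiniteDimensional ℝ E] [MeasurableSpace E] [BorelSpace E] (u : E) (hu : ‖u‖ = 1)
    (σ : Measure E) (hinv : ∀ φ : E ≃ₗᵢ[ℝ] E, MeasurePreserving φ σ σ)
    (r R : ℝ) (hr : 0 < r) (hR : r < R) (hσ : σ (Metric.sphere 0 R)ᶜ = 0)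
    (v x : E) (hv : ‖v‖ = 1) (hx : ‖x‖ = R) (h0 : 0 ≤ ⟪v, x⟫) (h1 : ⟪v, x⟫ ≤ r)
    (hT : σ ((fun x => ⟪u, x⟫) ⁻¹' {t | |t| ≤ r}) < ∞) : σ Set.univ < ∞ := by
  have : ProperSpace E := FiniteDimensional.proper ℝ E
  set y := x - ⟪v, x⟫ • v with hy
  have hvy : ⟪v, y⟫ = 0 := by
    rw [hy, inner_sub_right, inner_smul_right, real_inner_self_eq_norm_sq, hv]; ring
  have hy0 : y ≠ 0 := by
    intro h
    have hx' : x = ⟪v, x⟫ • v := sub_eq_zero.1 h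
    have : ‖x‖ = ⟪v, x⟫ := by
      conv_lhs => rw [hx']
      rw [norm_smul, hv, mul_one, Real.norm_of_nonneg h0]
    linarith
  have hyn : 0 < ‖y‖ := norm_pos_iff.2 hy0
  have hs : ∀ s : E, ‖s‖ = R → ∃ w : E, ‖w‖ = 1 ∧ ⟪w, s⟫ = 0 := by
    intro s hs
    obtain ⟨φ, hφ, -⟩ := exists_refl ((R / ‖y‖) • y) s (by
      rw [norm_smul, norm_div, norm_norm, div_mul_cancel₀ _ hyn.ne', hs,
        Real.norm_of_nonneg (by linarith)])
    refine ⟨φ v, by rw [φ.norm_map, hv], ?_⟩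
    rw [← hφ, φ.inner_map_map, inner_smul_right, hvy, mul_zero]
  choose! w hw1 hw2 using hs
  obtain ⟨t, htS, ht⟩ := (isCompact_sphere (0 : E) R).elim_nhds_subcover
    (fun s => {z | |⟪w s, z⟫| < r}) (fun s hs => by
      refine IsOpen.mem_nhds (isOpen_lt (by fun_prop) continuous_const) ?_
      have := hw2 s (by simpa using hs)
      simp [this, hr])
  rw [← Set.union_compl_self (Metric.sphere (0 : E) R)]
  refine (measure_union_le _ _).trans_lt ?_
  rw [hσ, add_zero]
  refine (measure_mono ht).trans_lt ?_
  refine (measure_biUnion_finset_le _ _).trans_lt ?_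
  refine ENNReal.sum_lt_top.2 fun s hs => ?_
  refine lt_of_le_of_lt ?_ hT
  rw [← inv_inner u (w s) (by rw [hu, hw1 s (by simpa using htS s hs)]) σ hinv]
  refine measure_mono fun z hz => ?_
  have hz' : |⟪w s, z⟫| < r := hz
  exact hz'.le

theorem sphere_slice_convex_le_plank (n : ℕ)
    (K : Set (EuclideanSpace ℝ (Fin n)))
    (hKconv : Convex ℝ K) (hKcomp : IsCompact K) (hKint : (interior K).Nonempty)
    (r : ℝ) (hr : 0 < r)
    (hball : Metric.closedBall 0 r ⊆ K)
    (hmax : ∀ (c : EuclideanSpace ℝ (Fin n)) (R : ℝ), Metric.closedBall c R ⊆ K → R ≤ r)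
    (R : ℝ) (hR : r < R)
    (u : EuclideanSpace ℝ (Fin n)) (hu : ‖u‖ = 1) :
    μH[(n : ℝ) - 1] (K ∩ Metric.sphere (0 : EuclideanSpace ℝ (Fin n)) R)
      ≤ μH[(n : ℝ) - 1] ({x | |⟪u, x⟫| ≤ r} ∩ Metric.sphere (0 : EuclideanSpace ℝ (Fin n)) R) := by
  have hSm : MeasurableSet (Metric.sphere (0 : EuclideanSpace ℝ (Fin n)) R) :=
    Metric.isClosed_sphere.measurableSet
  set σ : Measure (EuclideanSpace ℝ (Fin n)) :=
    (μH[(n : ℝ) - 1]).restrict (Metric.sphere 0 R) with hσdef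
  have hinv : ∀ φ : EuclideanSpace ℝ (Fin n) ≃ₗᵢ[ℝ] EuclideanSpace ℝ (Fin n),
      MeasurePreserving φ σ σ := by
    intro φ
    have h1 := (φ.toIsometryEquiv.measurePreserving_hausdorffMeasure ((n : ℝ) - 1)).restrict_preimage
      hSm
    have h2 : φ.toIsometryEquiv ⁻¹' (Metric.sphere 0 R) = Metric.sphere 0 R := by
      ext x
      simp
    rw [h2] at h1
    exact h1
  have hσ : σ (Metric.sphere 0 R)ᶜ = 0 := by
    rw [hσdef, Measure.restrict_apply hSm.compl]
    simp
  obtain ⟨k, i0, v, hv, hpos, hK⟩ := exists_family K hKconv hKcomp r hr hball hmax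
  rcases (K ∩ Metric.sphere (0 : EuclideanSpace ℝ (Fin n)) R).eq_empty_or_nonempty with h | h
  · rw [h, measure_empty]; exact zero_le
  rw [← Measure.restrict_apply' hSm, ← Measure.restrict_apply' hSm, ← hσdef]
  change σ K ≤ σ ((fun x => ⟪u, x⟫) ⁻¹' {t | |t| ≤ r})
  rcases eq_or_ne (σ ((fun x => ⟪u, x⟫) ⁻¹' {t | |t| ≤ r})) ∞ with hT | hT
  · rw [hT]; exact le_top
  obtain ⟨x, hxK, hxS⟩ := h
  have hex : ∃ i, 0 ≤ ⟪v i, x⟫ := by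
    by_contra hcon
    push Not at hcon
    have := hpos x (fun i => (hcon i).le) i0
    linarith [hcon i0]
  obtain ⟨i, hi⟩ := hex
  have hfin := finite_of_plank u hu σ hinv r R hr hR hσ (v i) x (hv i) (by simpa using hxS) hi
    (hK x hxK i) hT.lt_top
  have : IsFiniteMeasure σ := ⟨hfin⟩
  exact finite_case u hu σ hinv r R hr hR hσ k i0 v hv hpos K hKcomp.isClosed.measurableSet hK
end

section
/- If the unit sphere S^n is covered by finitely many closed spherically convex sets K₁, …, K_m, then ∑_{i=1}^m r(K_i) ≥ π, where r(K) is the radius of the largest spherical ball contained in K. -/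
open RealInnerProductSpace

/-- Geodesic distance between two points of the unit sphere in Euclidean space. -/
noncomputable def geodist {n : ℕ} (x y : EuclideanSpace ℝ (Fin n)) : ℝ :=
  Real.arccos ⟪x, y⟫

/-- The spherical inradius of a subset `K` of the unit sphere: the supremum of radii
`ρ ≥ 0` of spherical balls (in the geodesic metric) contained in `K`. -/
noncomputable def sphericalInradius {n : ℕ} (K : Set (EuclideanSpace ℝ (Fin n))) : ℝ :=
  sSup {ρ : ℝ | 0 ≤ ρ ∧ ∃ o : EuclideanSpace ℝ (Fin n), ‖o‖ = 1 ∧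
    ∀ x, ‖x‖ = 1 → geodist o x ≤ ρ → x ∈ K}


namespace BS

open MeasureTheory ProbabilityTheory Set
open scoped ENNReal

set_option linter.unusedSectionVars false

variable {E : Type*} [NormedAddCommGroup E] [InnerProductSpace ℝ E] [FiniteDimensional ℝ E]
  [MeasurableSpace E] [BorelSpace E]

/-- Decomposition of the standard Gaussian along a unit vector. -/
lemma gauss_dec (p : E) (hp : ‖p‖ = 1) :
    ((gaussianReal 0 1).prod (stdGaussian E)).map
      (fun q : ℝ × E => q.1 • p + (q.2 - ⟪p, q.2⟫ • p)) = stdGaussian E := by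
  have h1 : ((gaussianReal 0 1).prod (stdGaussian E)).map
      (fun q : ℝ × E => q.1 • p + (q.2 - ⟪p, q.2⟫ • p)) =
      (((gaussianReal 0 1).map (fun t : ℝ => t • p)).prod
        ((stdGaussian E).map (fun x : E => x - ⟪p, x⟫ • p))).map (fun q => q.1 + q.2) := by
    rw [Measure.map_prod_map _ _ (by fun_prop) (by fun_prop), Measure.map_map (by fun_prop) (by fun_prop)]
    rfl
  rw [h1]
  have i1 : IsProbabilityMeasure ((gaussianReal 0 1).map (fun t : ℝ => t • p)) :=
    Measure.isProbabilityMeasure_map (by fun_prop)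
  have i2 : IsProbabilityMeasure ((stdGaussian E).map (fun x : E => x - ⟪p, x⟫ • p)) :=
    Measure.isProbabilityMeasure_map (by fun_prop)
  apply Measure.ext_of_charFun
  rw [charFun_map_add_prod_eq_mul]
  ext t
  have e1 : charFun ((gaussianReal 0 1).map (fun t : ℝ => t • p)) t
      = charFun (gaussianReal 0 1) ⟪p, t⟫ := by
    rw [charFun_apply, charFun_apply_real, integral_map (by fun_prop) (by fun_prop)]
    simp only [real_inner_smul_left, Complex.ofReal_mul]
    congr 1; ext x; ring_nf
  have e2 : charFun ((stdGaussian E).map (fun x : E => x - ⟪p, x⟫ • p)) t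
      = charFun (stdGaussian E) (t - ⟪p, t⟫ • p) := by
    rw [charFun_apply, charFun_apply, integral_map (by fun_prop) (by fun_prop)]
    simp only [inner_sub_left, inner_sub_right, real_inner_smul_left, real_inner_smul_right]
    congr 1; ext x; rw [real_inner_comm p x, mul_comm ⟪p, t⟫]
  simp only [Pi.mul_apply]
  rw [e1, e2, charFun_stdGaussian, charFun_stdGaussian, charFun_gaussianReal, ← Complex.exp_add]
  congr 1
  have : ‖t - ⟪p, t⟫ • p‖ ^ 2 = ‖t‖ ^ 2 - ⟪p, t⟫ ^ 2 := by
    rw [norm_sub_sq_real, norm_smul, hp, real_inner_smul_right, real_inner_comm t p]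
    simp; ring
  have this' : ((‖t - ⟪p, t⟫ • p‖ : ℝ) : ℂ) ^ 2 = (‖t‖ : ℂ) ^ 2 - (⟪p, t⟫ : ℂ) ^ 2 := by
    exact_mod_cast this
  rw [this']
  push_cast; simp; ring

lemma gauss_lint (p : E) (hp : ‖p‖ = 1) (f : E → ℝ≥0∞) (hf : Measurable f) :
    ∫⁻ x, f x ∂(stdGaussian E) =
      ∫⁻ x, ∫⁻ t, f (t • p + (x - ⟪p, x⟫ • p)) ∂(gaussianReal 0 1) ∂(stdGaussian E) := by
  conv_lhs => rw [← gauss_dec p hp]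
  rw [lintegral_map hf (by fun_prop), lintegral_prod_symm _ (by fun_prop)]

lemma gauss_meas (p : E) (hp : ‖p‖ = 1) (D : Set E) (hD : MeasurableSet D) :
    stdGaussian E D =
      ∫⁻ x, gaussianReal 0 1 {t | t • p + (x - ⟪p, x⟫ • p) ∈ D} ∂(stdGaussian E) := by
  rw [← lintegral_indicator_one hD, gauss_lint p hp _ (measurable_one.indicator hD)]
  congr 1; ext x
  have : MeasurableSet {t : ℝ | t • p + (x - ⟪p, x⟫ • p) ∈ D} := by
    have : Measurable (fun t : ℝ => t • p + (x - ⟪p, x⟫ • p)) := by fun_prop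
    exact this hD
  rw [← lintegral_indicator_one this]
  rfl

lemma gauss_neg : (stdGaussian E).map (fun x => -x) = stdGaussian E :=
  stdGaussian_map (LinearIsometryEquiv.neg ℝ)

lemma gauss_half (o : E) : stdGaussian E {x | 0 < ⟪o, x⟫} ≤ ENNReal.ofReal (1 / 2) := by
  have hm : MeasurableSet {x : E | 0 < ⟪o, x⟫} := measurableSet_lt (by fun_prop) (by fun_prop)
  have hm' : MeasurableSet {x : E | ⟪o, x⟫ < 0} := measurableSet_lt (by fun_prop) (by fun_prop)
  have h1 : stdGaussian E {x | 0 < ⟪o, x⟫} = stdGaussian E {x | ⟪o, x⟫ < 0} := by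
    conv_lhs => rw [← gauss_neg, Measure.map_apply (by fun_prop) hm]
    congr 1; ext x; simp
  have h2 : stdGaussian E {x | 0 < ⟪o, x⟫} + stdGaussian E {x | ⟪o, x⟫ < 0} ≤ 1 := by
    rw [← measure_union _ hm']
    · exact prob_le_one
    · rw [Set.disjoint_left]; intro x hx hx'; simp at hx hx'; linarith
  rw [← h1, ← two_mul] at h2
  rw [ENNReal.ofReal_div_of_pos (by norm_num)]
  simp only [ENNReal.ofReal_one, ENNReal.ofReal_ofNat]
  rw [ENNReal.le_div_iff_mul_le (by simp) (by simp), mul_comm]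
  exact h2

lemma gauss_hyper (v : E) (hv : ‖v‖ = 1) : stdGaussian E {x | ⟪v, x⟫ = 0} = 0 := by
  rw [gauss_meas v hv _ (measurableSet_eq_fun (by fun_prop) (by fun_prop))]
  have : ∀ x : E, {t : ℝ | t • v + (x - ⟪v, x⟫ • v) ∈ {x | ⟪v, x⟫ = 0}} = {0} := by
    intro x; ext t
    simp [inner_add_right, inner_sub_right, real_inner_smul_right, hv]
  simp_rw [this]
  have : NullSingletonClass (gaussianReal 0 1) := nullSingletonClass_gaussianReal (by simp)
  simp

/-- One-dimensional inequality for upper sets. -/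
lemma oneD (U : Set ℝ) (hU : ∀ x ∈ U, ∀ y, x ≤ y → y ∈ U) (hU0 : ∀ x ∈ U, 0 ≤ x)
    (t : ℝ) :
    gaussianReal 0 1 (U ∩ Iic t) ≤ 2 * gaussianReal 0 1 U * gaussianReal 0 1 (Icc 0 t) := by
  set g := gaussianReal 0 1 with hg
  by_cases hne : (U ∩ Iic t).Nonempty
  swap
  · rw [not_nonempty_iff_eq_empty] at hne; simp [hne]
  obtain ⟨u, hu, hut⟩ := hne
  have hIoi : Ioi t ⊆ U := fun y hy => hU u hu y (le_trans hut (le_of_lt hy))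
  have h0t : 0 ≤ t := (hU0 u hu).trans hut
  have hsum : g U = g (U ∩ Iic t) + g (Ioi t) := by
    rw [← measure_inter_add_sdiff U (measurableSet_Iic (a := t))]
    congr 2
    ext x; simp only [mem_sdiff, mem_Iic, not_le, mem_Ioi]
    exact ⟨fun h => h.2, fun h => ⟨hIoi h, h⟩⟩
  have hle : g (U ∩ Iic t) ≤ g (Icc 0 t) :=
    measure_mono (fun x hx => ⟨hU0 x hx.1, hx.2⟩)
  have hat : NullSingletonClass g := nullSingletonClass_gaussianReal (by simp)
  have hhalf : 2 * (g (Icc 0 t) + g (Ioi t)) = 1 := by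
    have a1 : g (Icc 0 t) + g (Ioi t) = g (Ici 0) := by
      rw [← measure_union _ measurableSet_Ioi, Icc_union_Ioi_eq_Ici h0t]
      rw [Set.disjoint_left]; intro x hx hx'; exact absurd hx.2 (not_le.2 hx')
    have a2 : g (Ici 0) = g (Iio 0) := by
      have : g.map (fun x => -x) = g := by rw [hg, gaussianReal_map_neg]; simp
      conv_lhs => rw [← this, Measure.map_apply (by fun_prop) measurableSet_Ici]
      rw [← measure_congr (Iio_ae_eq_Iic (μ := g) (a := 0)).symm]
      congr 1; ext x; simp
    rw [a1, two_mul]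
    nth_rewrite 1 [a2]
    rw [← measure_union _ measurableSet_Ici, Iio_union_Ici, measure_univ]
    rw [Set.disjoint_left]; intro x hx hx'; exact absurd (mem_Ici.1 hx') (not_le.2 hx)
  rw [hsum]
  set α := g (U ∩ Iic t)
  set β := g (Icc 0 t)
  set Q := g (Ioi t)
  calc α = α * (2 * (β + Q)) := by rw [hhalf, mul_one]
    _ = 2 * (α * β + α * Q) := by ring
    _ ≤ 2 * (α * β + β * Q) := by gcongr
    _ = 2 * (α + Q) * β := by ring

lemma sector_meas (c : ℝ) : MeasurableSet {q : ℝ × ℝ | 0 ≤ q.2 ∧ q.2 ≤ c * q.1} := by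
  have a : MeasurableSet {q : ℝ × ℝ | 0 ≤ q.2} := measurableSet_le (by fun_prop) (by fun_prop)
  have b : MeasurableSet {q : ℝ × ℝ | q.2 ≤ c * q.1} :=
    measurableSet_le (by fun_prop) (by fun_prop)
  exact a.inter b

lemma sector_aux (ρ : ℝ) (h0 : 0 < ρ) (h1 : ρ < Real.pi / 2) (r θ : ℝ) (hr : 0 < r)
    (hθ : θ ∈ Ioo (-Real.pi) Real.pi) (hs : 0 ≤ r * Real.sin θ)
    (hc : r * Real.sin θ ≤ Real.tan ρ * (r * Real.cos θ)) : θ ∈ Icc 0 ρ := by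
  have hcos : 0 < Real.cos ρ := Real.cos_pos_of_mem_Ioo ⟨by linarith, h1⟩
  have hs' : 0 ≤ Real.sin θ := nonneg_of_mul_nonneg_right hs hr
  have hθ0 : 0 ≤ θ := by
    by_contra h
    push Not at h
    have := Real.sin_neg_of_neg_of_neg_pi_lt h hθ.1
    linarith
  refine ⟨hθ0, ?_⟩
  by_contra h
  push Not at h
  have h3 : Real.sin (θ - ρ) > 0 := Real.sin_pos_of_pos_of_lt_pi (by linarith) (by linarith [hθ.2])
  rw [Real.sin_sub] at h3
  rw [Real.tan_eq_sin_div_cos, div_mul_eq_mul_div, le_div_iff₀ hcos] at hc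
  have : r * (Real.sin θ * Real.cos ρ) ≤ r * (Real.cos θ * Real.sin ρ) := by nlinarith
  have := le_of_mul_le_mul_left this hr
  linarith

lemma gpdf_mul (r θ : ℝ) : gaussianPDF 0 1 (r * Real.cos θ) * gaussianPDF 0 1 (r * Real.sin θ)
    = ENNReal.ofReal ((2 * Real.pi)⁻¹ * Real.exp (- r ^ 2 / 2)) := by
  rw [gaussianPDF, gaussianPDF, ← ENNReal.ofReal_mul (gaussianPDFReal_nonneg _ _ _)]
  congr 1
  simp only [gaussianPDFReal, NNReal.coe_one, mul_one, sub_zero]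
  rw [mul_mul_mul_comm, ← mul_inv, Real.mul_self_sqrt (by positivity), ← Real.exp_add]
  congr 2
  have := Real.sin_sq_add_cos_sq θ
  linear_combination (-r^2/2) * this

lemma sector (ρ : ℝ) (h0 : 0 < ρ) (h1 : ρ < Real.pi / 2) :
    ∫⁻ a, gaussianReal 0 1 (Icc 0 (Real.tan ρ * a)) ∂(gaussianReal 0 1)
      ≤ ENNReal.ofReal (ρ / (2 * Real.pi)) := by
  set S : Set (ℝ × ℝ) := {q | 0 ≤ q.2 ∧ q.2 ≤ Real.tan ρ * q.1} with hS
  have hSm : MeasurableSet S :=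
    sector_meas _
  have e1 : ∫⁻ a, gaussianReal 0 1 (Icc 0 (Real.tan ρ * a)) ∂(gaussianReal 0 1)
      = ((gaussianReal 0 1).prod (gaussianReal 0 1)) S := by
    rw [Measure.prod_apply hSm]
    rfl
  rw [e1, gaussianReal_of_var_ne_zero 0 (by simp), prod_withDensity (by fun_prop) (by fun_prop),
    withDensity_apply _ hSm, ← lintegral_indicator hSm, ← Measure.volume_eq_prod,
    ← lintegral_comp_polarCoord_symm]
  have hle : ∀ p ∈ polarCoord.target, ENNReal.ofReal p.1 • (S.indicator
      (fun a : ℝ × ℝ => gaussianPDF 0 1 a.1 * gaussianPDF 0 1 a.2) (polarCoord.symm p)) ≤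
      ENNReal.ofReal ((2 * Real.pi)⁻¹ * (p.1 * Real.exp (- p.1 ^ 2 / 2))) *
        (Icc 0 ρ).indicator (1 : ℝ → ℝ≥0∞) p.2 := by
    rintro ⟨r, θ⟩ hp
    simp only [polarCoord_target, mem_prod, mem_Ioi] at hp
    simp only [polarCoord_symm_apply]
    by_cases hq : (r * Real.cos θ, r * Real.sin θ) ∈ S
    · rw [indicator_of_mem hq, indicator_of_mem (sector_aux ρ h0 h1 r θ hp.1 hp.2 hq.1 hq.2),
        gpdf_mul, smul_eq_mul, ← ENNReal.ofReal_mul hp.1.le]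
      simp only [Pi.one_apply, mul_one]
      apply le_of_eq; congr 1; ring
    · rw [indicator_of_notMem hq]; simp
  refine (setLIntegral_mono' polarCoord.open_target.measurableSet hle).trans ?_
  rw [polarCoord_target, Measure.volume_eq_prod, ← Measure.prod_restrict,
    lintegral_prod_mul
      (f := fun r : ℝ => ENNReal.ofReal ((2 * Real.pi)⁻¹ * (r * Real.exp (- r ^ 2 / 2))))
      (g := (Icc 0 ρ).indicator (1 : ℝ → ℝ≥0∞)) (by fun_prop)
      (measurable_one.indicator measurableSet_Icc).aemeasurable]
  have i1 : ∫⁻ r in Ioi (0:ℝ), ENNReal.ofReal ((2 * Real.pi)⁻¹ * (r * Real.exp (- r ^ 2 / 2)))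
      = ENNReal.ofReal ((2 * Real.pi)⁻¹) := by
    have hf : ∀ r : ℝ, r * Real.exp (- r ^ 2 / 2) = r * Real.exp (- (1/2) * r ^ 2) := by
      intro r; congr 2; ring
    simp_rw [hf]
    have hintg := integrable_mul_exp_neg_mul_sq (b := 1/2) (by norm_num)
    rw [← ofReal_integral_eq_lintegral_ofReal]
    · congr 1
      rw [integral_const_mul]
      have := integral_mul_cexp_neg_mul_sq (b := 1/2) (by norm_num)
      have h2 : ((∫ r in Ioi (0:ℝ), r * Real.exp (- (1/2) * r ^ 2) : ℝ) : ℂ) = 1 := by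
        rw [← integral_complex_ofReal]
        push_cast
        rw [this]; norm_num
      have h3 : (∫ r in Ioi (0:ℝ), r * Real.exp (- (1/2) * r ^ 2)) = 1 := by exact_mod_cast h2
      rw [h3, mul_one]
    · exact (hintg.const_mul _).integrableOn
    · refine (ae_restrict_iff' measurableSet_Ioi).2 (ae_of_all _ fun r hr => ?_)
      have : 0 < r := hr
      simp only [Pi.zero_apply]; positivity
  rw [i1]
  have i2 : ∫⁻ θ in Ioo (-Real.pi) Real.pi, (Icc 0 ρ).indicator (1 : ℝ → ℝ≥0∞) θ
      ≤ ENNReal.ofReal ρ := by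
    refine (lintegral_mono' Measure.restrict_le_self le_rfl).trans ?_
    rw [lintegral_indicator_one measurableSet_Icc, Real.volume_Icc, sub_zero]
  refine (mul_le_mul_right i2 _).trans ?_
  rw [← ENNReal.ofReal_mul (by positivity)]
  apply le_of_eq; congr 1; field_simp

/-- The main estimate on one cell. -/
lemma core (o p : E) (ho : ‖o‖ = 1) (hp : ‖p‖ = 1) (hop : ⟪o, p⟫ = 0) (D : Set E)
    (hD : MeasurableSet D) (hDp : ∀ x ∈ D, ∀ t : ℝ, 0 ≤ t → x + t • p ∈ D)
    (hDo : ∀ x ∈ D, ∀ t : ℝ, x + t • o ∈ D) (hD0 : ∀ x ∈ D, 0 ≤ ⟪p, x⟫)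
    (ρ : ℝ) (h0 : 0 < ρ) (h1 : ρ < Real.pi / 2) :
    stdGaussian E (D ∩ {x | ⟪p, x⟫ ≤ Real.tan ρ * ⟪o, x⟫}) ≤
      stdGaussian E D * ENNReal.ofReal (ρ / Real.pi) := by
  have hpo : ⟪p, o⟫ = 0 := by rw [real_inner_comm]; exact hop
  have hW : MeasurableSet {x : E | ⟪p, x⟫ ≤ Real.tan ρ * ⟪o, x⟫} :=
    measurableSet_le (by fun_prop) (by fun_prop)
  set U : E → Set ℝ := fun x => {t | t • p + (x - ⟪p, x⟫ • p) ∈ D} with hUdef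
  have hUo : ∀ x (a : ℝ), U (x + a • o) = U x := by
    intro x a
    have key : ∀ y (b : ℝ), U y ⊆ U (y + b • o) := by
      intro y b t ht
      have := hDo _ ht b
      simp only [hUdef, mem_ofPred_eq, inner_add_right, real_inner_smul_right, hpo]
      convert this using 1
      simp only [mul_zero, add_zero]; abel
    refine Subset.antisymm ?_ (key x a)
    have := key (x + a • o) (-a)
    simpa using this
  have hUmeas : Measurable (fun x => gaussianReal 0 1 (U x)) := by
    have hm : MeasurableSet {q : E × ℝ | q.2 • p + (q.1 - ⟪p, q.1⟫ • p) ∈ D} := by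
      have : Measurable (fun q : E × ℝ => q.2 • p + (q.1 - ⟪p, q.1⟫ • p)) := by fun_prop
      exact this hD
    exact measurable_measure_prodMk_left hm
  have hImeas : Measurable (fun a : ℝ => gaussianReal 0 1 (Icc 0 (Real.tan ρ * a))) := by
    have hm : MeasurableSet {q : ℝ × ℝ | 0 ≤ q.2 ∧ q.2 ≤ Real.tan ρ * q.1} :=
      sector_meas _
    exact measurable_measure_prodMk_left hm
  have hUD : stdGaussian E D = ∫⁻ x, gaussianReal 0 1 (U x) ∂(stdGaussian E) :=
    gauss_meas p hp D hD
  rw [gauss_meas p hp _ (hD.inter hW)]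
  have step : ∀ x : E, gaussianReal 0 1 {t | t • p + (x - ⟪p, x⟫ • p) ∈
      D ∩ {x | ⟪p, x⟫ ≤ Real.tan ρ * ⟪o, x⟫}} ≤
      2 * gaussianReal 0 1 (U x) * gaussianReal 0 1 (Icc 0 (Real.tan ρ * ⟪o, x⟫)) := by
    intro x
    refine le_trans (le_of_eq ?_) (oneD (U x) ?_ ?_ _)
    · congr 1; ext t
      simp [hUdef, inner_add_right, inner_sub_right, real_inner_smul_right, hp, hop]
    · intro t ht u htu
      have := hDp _ ht (u - t) (by linarith)
      simp only [hUdef, mem_ofPred_eq]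
      convert this using 1
      rw [sub_smul]; abel
    · intro t ht
      have := hD0 _ ht
      simpa [inner_add_right, inner_sub_right, real_inner_smul_right, hp] using this
  refine (lintegral_mono step).trans ?_
  have hmeas : Measurable (fun x : E => 2 * gaussianReal 0 1 (U x) *
      gaussianReal 0 1 (Icc 0 (Real.tan ρ * ⟪o, x⟫))) :=
    (hUmeas.const_mul 2).mul (hImeas.comp (by fun_prop : Measurable (fun x : E => ⟪o, x⟫)))
  rw [gauss_lint o ho _ hmeas]
  have e : ∀ (x : E) (a : ℝ), 2 * gaussianReal 0 1 (U (a • o + (x - ⟪o, x⟫ • o))) *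
      gaussianReal 0 1 (Icc 0 (Real.tan ρ * ⟪o, a • o + (x - ⟪o, x⟫ • o)⟫)) =
      2 * gaussianReal 0 1 (U x) * gaussianReal 0 1 (Icc 0 (Real.tan ρ * a)) := by
    intro x a
    have : a • o + (x - ⟪o, x⟫ • o) = x + (a - ⟪o, x⟫) • o := by rw [sub_smul]; abel
    have h2 : ⟪o, a • o + (x - ⟪o, x⟫ • o)⟫ = a := by
      simp [inner_add_right, inner_sub_right, real_inner_smul_right, ho]
    rw [h2, this, hUo]
  simp_rw [e]
  have e3 : ∀ x : E, ∫⁻ a, 2 * gaussianReal 0 1 (U x) *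
      gaussianReal 0 1 (Icc 0 (Real.tan ρ * a)) ∂(gaussianReal 0 1) ≤
      gaussianReal 0 1 (U x) * ENNReal.ofReal (ρ / Real.pi) := by
    intro x
    rw [lintegral_const_mul _ hImeas]
    refine (mul_le_mul_right (sector ρ h0 h1) _).trans (le_of_eq ?_)
    rw [mul_comm 2, mul_assoc]
    congr 1
    rw [← ENNReal.ofReal_ofNat, ← ENNReal.ofReal_mul (by norm_num)]
    congr 1
    have := Real.pi_pos
    field_simp
  refine (lintegral_mono e3).trans ?_
  rw [lintegral_mul_const _ hUmeas, hUD]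

/-- Polytopal estimate: a wedge cut out by contact hyperplanes has measure at most `ρ / π`. -/
lemma wedge_bound {ι : Type*} [Fintype ι] [LinearOrder ι] [Nonempty ι] (w : ι → ℝ) (p : ι → E)
    (o : E) (ho : ‖o‖ = 1) (hw : ∀ i, 0 < w i) (hp : ∀ i, ‖p i‖ = 1) (hop : ∀ i, ⟪o, p i⟫ = 0)
    (hsum : ∑ i, w i • p i = 0) (ρ : ℝ) (h0 : 0 < ρ) (h1 : ρ < Real.pi / 2) :
    stdGaussian E {x | ∀ i, ⟪p i, x⟫ ≤ Real.tan ρ * ⟪o, x⟫} ≤ ENNReal.ofReal (ρ / Real.pi) := by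
  set D : ι → Set E := fun i => {x | ∀ j, ⟪p j, x⟫ ≤ ⟪p i, x⟫ ∧ (j < i → ⟪p j, x⟫ < ⟪p i, x⟫)}
    with hDdef
  have hDm : ∀ i, MeasurableSet (D i) := by
    intro i
    have : D i = ⋂ j, ({x | ⟪p j, x⟫ ≤ ⟪p i, x⟫} ∩
        (if j < i then {x | ⟪p j, x⟫ < ⟪p i, x⟫} else univ)) := by
      ext x
      simp only [hDdef, mem_ofPred_eq, mem_iInter, mem_inter_iff]
      refine forall_congr' fun j => and_congr Iff.rfl ?_
      split_ifs with h <;> simp [h]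
    rw [this]
    refine MeasurableSet.iInter fun j => MeasurableSet.inter
      (measurableSet_le (by fun_prop) (by fun_prop)) ?_
    split_ifs
    · exact measurableSet_lt (by fun_prop) (by fun_prop)
    · exact MeasurableSet.univ
  have hcov : ∀ x, ∃ i, x ∈ D i := by
    intro x
    obtain ⟨i0, -, hi0⟩ := Finset.exists_max_image Finset.univ (fun i => ⟪p i, x⟫)
      Finset.univ_nonempty
    obtain ⟨i, hi, hmin⟩ := Finset.exists_min_image
      (Finset.univ.filter (fun i => ⟪p i0, x⟫ ≤ ⟪p i, x⟫)) id ⟨i0, by simp⟩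
    simp only [Finset.mem_filter, Finset.mem_univ, true_and, id] at hi hmin hi0
    refine ⟨i, fun j => ⟨(hi0 j trivial).trans hi, fun hji => ?_⟩⟩
    by_contra hcon
    push Not at hcon
    exact absurd (hmin j (hi.trans hcon)) (not_le.2 hji)
  have hdisj : Pairwise (Function.onFun Disjoint D) := by
    intro i j hij
    rw [Function.onFun, Set.disjoint_left]
    intro x hx hx'
    rcases lt_or_gt_of_ne hij with h | h
    · have := (hx' i).2 h; have := (hx j).1; linarith
    · have := (hx j).2 h; have := (hx' i).1; linarith
  have hle1 : ∀ i j, ⟪p j, p i⟫ ≤ 1 := by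
    intro i j
    have := real_inner_le_norm (p j) (p i)
    rwa [hp, hp, mul_one] at this
  have hcore : ∀ i, stdGaussian E (D i ∩ {x | ⟪p i, x⟫ ≤ Real.tan ρ * ⟪o, x⟫}) ≤
      stdGaussian E (D i) * ENNReal.ofReal (ρ / Real.pi) := by
    intro i
    refine core o (p i) ho (hp i) (hop i) (D i) (hDm i) ?_ ?_ ?_ ρ h0 h1
    · intro x hx t ht j
      have hpi : ⟪p i, p i⟫ = 1 := by rw [real_inner_self_eq_norm_sq, hp]; norm_num
      have h3 : t * ⟪p j, p i⟫ ≤ t := by nlinarith [hle1 i j]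
      simp only [inner_add_right, real_inner_smul_right, hpi]
      refine ⟨by linarith [(hx j).1], fun hji => by linarith [(hx j).2 hji]⟩
    · intro x hx t j
      have : ∀ k, ⟪p k, o⟫ = 0 := fun k => by rw [real_inner_comm]; exact hop k
      simp only [inner_add_right, real_inner_smul_right, this, mul_zero, add_zero]
      exact hx j
    · intro x hx
      by_contra hneg
      push Not at hneg
      have e : ∑ j, w j * ⟪p j, x⟫ = 0 := by
        have := congrArg (fun y => ⟪y, x⟫) hsum
        simpa [sum_inner, real_inner_smul_left] using this
      have : ∑ j, w j * ⟪p j, x⟫ < 0 := by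
        apply Finset.sum_neg
        · intro j _
          exact mul_neg_of_pos_of_neg (hw j) (lt_of_le_of_lt (hx j).1 hneg)
        · exact Finset.univ_nonempty
      linarith
  calc stdGaussian E {x | ∀ i, ⟪p i, x⟫ ≤ Real.tan ρ * ⟪o, x⟫}
      ≤ stdGaussian E (⋃ i, (D i ∩ {x | ⟪p i, x⟫ ≤ Real.tan ρ * ⟪o, x⟫})) := by
        apply measure_mono
        intro x hx
        obtain ⟨i, hi⟩ := hcov x
        exact mem_iUnion.2 ⟨i, hi, hx i⟩
    _ ≤ ∑ i, stdGaussian E (D i ∩ {x | ⟪p i, x⟫ ≤ Real.tan ρ * ⟪o, x⟫}) := by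
        refine (measure_iUnion_le _).trans (le_of_eq (tsum_fintype _))
    _ ≤ ∑ i, stdGaussian E (D i) * ENNReal.ofReal (ρ / Real.pi) :=
        Finset.sum_le_sum fun i _ => hcore i
    _ = (stdGaussian E (⋃ i, D i)) * ENNReal.ofReal (ρ / Real.pi) := by
        rw [← Finset.sum_mul, measure_iUnion hdisj hDm, tsum_fintype]
    _ ≤ 1 * ENNReal.ofReal (ρ / Real.pi) := by gcongr; exact prob_le_one
    _ = _ := one_mul _

lemma cara (N : Set E) (v0 : E) (hv0 : v0 ∈ N) (x : E) (hx : x ∈ convexHull ℝ N) :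
    ∃ w ∈ stdSimplex ℝ (Fin (Module.finrank ℝ E + 1)), ∃ z : Fin (Module.finrank ℝ E + 1) → E,
      (∀ i, z i ∈ N) ∧ ∑ i, w i • z i = x := by
  obtain ⟨ι, _, z, w, hz, hind, hw, hw1, hx⟩ := eq_pos_convex_span_of_mem_convexHull hx
  have hcard : Fintype.card ι ≤ Module.finrank ℝ E + 1 :=
    hind.card_le_finrank_succ.trans (by gcongr; exact Submodule.finrank_le _)
  obtain ⟨e⟩ : Nonempty (ι ↪ Fin (Module.finrank ℝ E + 1)) :=
    Function.Embedding.nonempty_of_card_le (by simpa using hcard)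
  have hew : ∀ i, Function.extend e w 0 (e i) = w i := e.injective.extend_apply w 0
  have hez : ∀ i, Function.extend e z (fun _ => v0) (e i) = z i :=
    e.injective.extend_apply z _
  have hew0 : ∀ j ∉ range e, Function.extend e w 0 j = 0 := fun j hj =>
    Function.extend_apply' w (fun _ => (0 : ℝ)) j (fun ⟨a, ha⟩ => hj ⟨a, ha⟩)
  refine ⟨Function.extend e w 0, ⟨?_, ?_⟩, Function.extend e z (fun _ => v0), ?_, ?_⟩
  · intro j
    by_cases hj : j ∈ range e
    · obtain ⟨i, rfl⟩ := hj; rw [hew]; exact (hw i).le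
    · rw [hew0 j hj]
  · rw [← hw1]; symm
    exact Fintype.sum_of_injective e e.injective _ _ hew0 (fun i => (hew i).symm)
  · intro j
    by_cases hj : j ∈ range e
    · obtain ⟨i, rfl⟩ := hj; rw [hez]; exact hz ⟨i, rfl⟩
    · rw [Function.extend_apply' z _ j (fun ⟨a, ha⟩ => hj ⟨a, ha⟩)]; exact hv0
  · rw [← hx]; symm
    refine Fintype.sum_of_injective e e.injective _ _ ?_ (fun i => by rw [hew, hez])
    intro j hj; rw [hew0 j hj, zero_smul]

/-- Minimal norm point of the convex hull of a compact set. -/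
lemma exists_min (N : Set E) (hN : IsCompact N) (hne : N.Nonempty) :
    ∃ (k : ℕ) (w : Fin k → ℝ) (z : Fin k → E), (∀ i, 0 ≤ w i) ∧ ∑ i, w i = 1 ∧ (∀ i, z i ∈ N) ∧
      ∀ v ∈ N, ‖∑ i, w i • z i‖ ^ 2 ≤ ⟪∑ i, w i • z i, v⟫ := by
  obtain ⟨v0, hv0⟩ := hne
  set k := Module.finrank ℝ E + 1
  have hcomp : IsCompact ((stdSimplex ℝ (Fin k)) ×ˢ (Set.pi univ (fun _ : Fin k => N))) :=
    (isCompact_stdSimplex ℝ (Fin k)).prod (isCompact_univ_pi fun _ => hN)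
  have hne' : ((stdSimplex ℝ (Fin k)) ×ˢ (Set.pi univ (fun _ : Fin k => N))).Nonempty :=
    ⟨((Pi.single (0 : Fin k) (1 : ℝ) : Fin k → ℝ), fun _ => v0), single_mem_stdSimplex ℝ (0 : Fin k), fun _ _ => hv0⟩
  obtain ⟨⟨w, z⟩, ⟨hw, hz⟩, hmin⟩ := hcomp.exists_isMinOn hne'
    (f := fun q : (Fin k → ℝ) × (Fin k → E) => ‖∑ i, q.1 i • q.2 i‖) (by fun_prop)
  refine ⟨k, w, z, hw.1, hw.2, fun i => hz i trivial, fun v hv => ?_⟩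
  set q := ∑ i, w i • z i with hq
  have hqc : q ∈ convexHull ℝ N :=
    mem_convexHull_of_exists_fintype w z hw.1 hw.2 (fun i => hz i trivial) rfl
  have hmin' : ∀ y ∈ convexHull ℝ N, ‖q‖ ≤ ‖y‖ := by
    intro y hy
    obtain ⟨w', hw', z', hz', rfl⟩ := cara N v0 hv0 y hy
    exact hmin (a := (w', z')) ⟨hw', fun i _ => hz' i⟩
  by_contra hcon
  push Not at hcon
  set δ := ‖q‖ ^ 2 - ⟪q, v⟫ with hδ
  have hδ0 : 0 < δ := by linarith
  set M := ‖v - q‖ ^ 2 with hM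
  have hM0 : 0 ≤ M := by positivity
  have key : ∀ t : ℝ, 0 ≤ t → t ≤ 1 → 2 * t * δ ≤ t ^ 2 * M := by
    intro t ht0 ht1
    have hmem : q + t • (v - q) ∈ convexHull ℝ N := by
      have := (convex_convexHull ℝ N) hqc (subset_convexHull ℝ N hv) (sub_nonneg.2 ht1) ht0
        (by ring)
      convert this using 1
      rw [smul_sub, sub_smul, one_smul]; abel
    have h := hmin' _ hmem
    have h2 : ‖q‖ ^ 2 ≤ ‖q + t • (v - q)‖ ^ 2 := by gcongr
    rw [norm_add_sq_real, real_inner_smul_right, inner_sub_right, real_inner_self_eq_norm_sq,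
      norm_smul, mul_pow, Real.norm_eq_abs, sq_abs] at h2
    nlinarith
  have h1 := key (δ / (δ + M)) (by positivity) (by rw [div_le_one (by positivity)]; linarith)
  have hpos : 0 < δ / (δ + M) := by positivity
  have h2 : 2 * δ ≤ δ / (δ + M) * M := by
    have : δ / (δ + M) * (2 * δ) ≤ δ / (δ + M) * (δ / (δ + M) * M) := by nlinarith
    exact le_of_mul_le_mul_left this hpos
  have h3 : δ / (δ + M) * M ≤ δ := by
    rw [div_mul_eq_mul_div, div_le_iff₀ (by positivity)]; nlinarith
  linarith

/-- The cone over `K` equals its bidual. -/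
lemma bipolar (K : Set E) (hKS : K ⊆ {x | ‖x‖ = 1}) (hKcl : IsClosed K) (o' : E)
    (ho' : ∀ x ∈ K, 0 < ⟪o', x⟫)
    (hKconv : ∀ x ∈ K, ∀ y ∈ K, ∀ a b : ℝ, 0 ≤ a → 0 ≤ b →
      ‖a • x + b • y‖ = 1 → a • x + b • y ∈ K)
    (x : E) (hx : ‖x‖ = 1)
    (hd : ∀ v : E, ‖v‖ = 1 → (∀ k ∈ K, 0 ≤ ⟪v, k⟫) → 0 ≤ ⟪v, x⟫) : x ∈ K := by
  have hpos : ∀ y : E, y ≠ 0 → ‖y‖⁻¹ • y ∈ K → 0 < ⟪o', y⟫ := by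
    intro y hy hyK
    have := ho' _ hyK
    rw [real_inner_smul_right] at this
    exact pos_of_mul_pos_right this (by positivity)
  let C : ProperCone ℝ E :=
    { carrier := {y | y = 0 ∨ ‖y‖⁻¹ • y ∈ K}
      zero_mem' := Or.inl rfl
      add_mem' := by
        rintro a b (rfl | ha) (rfl | hb)
        · left; simp
        · right; simpa using hb
        · right; simpa using ha
        · by_cases ha0 : a = 0
          · subst ha0; right; simpa using hb
          by_cases hb0 : b = 0
          · subst hb0; right; simpa using ha
          right
          have h1 := hpos a ha0 ha
          have h2 := hpos b hb0 hb
          have hab : a + b ≠ 0 := by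
            intro h
            have : ⟪o', a + b⟫ = 0 := by rw [h, inner_zero_right]
            rw [inner_add_right] at this; linarith
          have hab' : ‖a + b‖ ≠ 0 := norm_ne_zero_iff.2 hab
          have ha' : ‖a‖ ≠ 0 := norm_ne_zero_iff.2 ha0
          have hb' : ‖b‖ ≠ 0 := norm_ne_zero_iff.2 hb0
          have e : ‖a + b‖⁻¹ • (a + b) = (‖a + b‖⁻¹ * ‖a‖) • (‖a‖⁻¹ • a) +
              (‖a + b‖⁻¹ * ‖b‖) • (‖b‖⁻¹ • b) := by
            rw [smul_smul, smul_smul, mul_assoc, mul_assoc, mul_inv_cancel₀ ha',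
              mul_inv_cancel₀ hb', mul_one, smul_add]
          have hn : ‖‖a + b‖⁻¹ • (a + b)‖ = 1 := by
            rw [norm_smul, norm_inv, norm_norm, inv_mul_cancel₀ hab']
          rw [e] at hn ⊢
          exact hKconv _ ha _ hb _ _ (by positivity) (by positivity) hn
      smul_mem' := by
        rintro c y (rfl | hy)
        · left; simp
        · rcases eq_or_ne c 0 with rfl | hc
          · left; simp
          · right
            have hc' : 0 < (c : ℝ) := lt_of_le_of_ne c.2 (fun h => hc (Subtype.ext h.symm))
            have : ‖c • y‖⁻¹ • (c • y) = ‖y‖⁻¹ • y := by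
              change ‖(c : ℝ) • y‖⁻¹ • ((c : ℝ) • y) = ‖y‖⁻¹ • y
              rw [norm_smul, Real.norm_of_nonneg hc'.le, smul_smul]
              congr 1
              rw [mul_inv]; field_simp
            rw [this]; exact hy
      isClosed' := by
        rw [← isOpen_compl_iff, isOpen_iff_eventually]
        intro y hy
        have hy' : ¬ (y = 0 ∨ ‖y‖⁻¹ • y ∈ K) := hy
        push Not at hy'
        have hcont : ContinuousAt (fun y : E => ‖y‖⁻¹ • y) y :=
          (continuousAt_id.norm.inv₀ (norm_ne_zero_iff.2 hy'.1)).smul continuousAt_id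
        have e1 : ∀ᶠ z in nhds y, z ≠ 0 := isOpen_ne.eventually_mem hy'.1
        have e2 : ∀ᶠ z in nhds y, ‖z‖⁻¹ • z ∈ Kᶜ :=
          hcont.eventually_mem (hKcl.isOpen_compl.mem_nhds hy'.2)
        filter_upwards [e1, e2] with z h1 h2
        intro hz
        rcases hz with h | h
        · exact h1 h
        · exact h2 h }
  have hC : ∀ y, y ∈ C ↔ (y = 0 ∨ ‖y‖⁻¹ • y ∈ K) := fun y => Iff.rfl
  by_contra hxK
  have hxC : x ∉ C := by
    rw [hC]; push Not
    refine ⟨fun h => by simp [h] at hx, ?_⟩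
    rwa [hx, inv_one, one_smul]
  obtain ⟨v, hv, hvx⟩ := C.hyperplane_separation' hxC
  have hv0 : v ≠ 0 := by rintro rfl; simp at hvx
  have hvn : 0 < ‖v‖ := norm_pos_iff.2 hv0
  have := hd (‖v‖⁻¹ • v) (by rw [norm_smul, norm_inv, norm_norm, inv_mul_cancel₀ hvn.ne'])
    (fun k hk => by
      have hk1 : ‖k‖ = 1 := hKS hk
      have := hv k ((hC k).2 (Or.inr (by rw [hk1, inv_one, one_smul]; exact hk)))
      rw [real_inner_smul_left, real_inner_comm]
      positivity)
  rw [real_inner_smul_left, real_inner_comm] at this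
  have h5 : ‖v‖⁻¹ * ⟪x, v⟫ < 0 := mul_neg_of_pos_of_neg (by positivity) hvx
  linarith

/-- The key estimate: the cone over `K` has small Gaussian measure. -/
lemma body (K : Set E) (hKS : K ⊆ {x | ‖x‖ = 1}) (hKcl : IsClosed K) (o' : E) (ho1 : ‖o'‖ = 1)
    (ho' : ∀ x ∈ K, 0 < ⟪o', x⟫)
    (hKconv : ∀ x ∈ K, ∀ y ∈ K, ∀ a b : ℝ, 0 ≤ a → 0 ≤ b →
      ‖a • x + b • y‖ = 1 → a • x + b • y ∈ K) :
    ∃ ρ : ℝ, 0 ≤ ρ ∧ stdGaussian E {x | x ≠ 0 ∧ ‖x‖⁻¹ • x ∈ K} ≤ ENNReal.ofReal (ρ / Real.pi) ∧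
      (ρ = 0 ∨ ∃ o : E, ‖o‖ = 1 ∧ ∀ x : E, ‖x‖ = 1 → Real.arccos ⟪o, x⟫ ≤ ρ → x ∈ K) := by
  set N : Set E := {v | ‖v‖ = 1 ∧ ∀ k ∈ K, 0 ≤ ⟪v, k⟫} with hN
  have hNc : IsCompact N := by
    have hcl : IsClosed N := by
      have : N = Metric.sphere (0 : E) 1 ∩ ⋂ k ∈ K, {v | 0 ≤ ⟪v, k⟫} := by
        ext v; simp [hN]
      rw [this]
      refine Metric.isClosed_sphere.inter (isClosed_biInter fun k _ => ?_)
      exact isClosed_le (by fun_prop) (by fun_prop)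
    exact (isCompact_sphere (0 : E) 1).of_isClosed_subset hcl (fun v hv => by simp [hv.1])
  obtain ⟨k, w, z, hw, hw1, hz, hmin⟩ :=
    exists_min N hNc ⟨o', ho1, fun x hx => (ho' x hx).le⟩
  set q := ∑ i, w i • z i with hq
  have hqx : ∀ x, ⟪q, x⟫ = ∑ i, w i * ⟪z i, x⟫ := by
    intro x; simp [hq, sum_inner, real_inner_smul_left]
  -- the cone lies in all the half-spaces
  have hsub : ∀ x ∈ {x : E | x ≠ 0 ∧ ‖x‖⁻¹ • x ∈ K}, ∀ v ∈ N, 0 ≤ ⟪v, x⟫ := by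
    rintro x ⟨hx0, hxK⟩ v hv
    have := hv.2 _ hxK
    rw [real_inner_smul_right] at this
    exact nonneg_of_mul_nonneg_right this (by positivity)
  obtain ⟨i0, hi0⟩ : ∃ i, 0 < w i := by
    by_contra h
    push Not at h
    have : ∑ i, w i ≤ 0 := Finset.sum_nonpos fun i _ => h i
    linarith
  rcases eq_or_ne q 0 with hq0 | hq0
  · refine ⟨0, le_rfl, ?_, Or.inl rfl⟩
    have : stdGaussian E {x | ⟪z i0, x⟫ = 0} = 0 := gauss_hyper _ (hz i0).1
    refine le_trans (measure_mono (fun x hx => ?_)) (le_of_eq_of_le this zero_le)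
    have h0 := hqx x
    rw [hq0, inner_zero_left] at h0
    have h1 := (Finset.sum_eq_zero_iff_of_nonneg (fun i _ =>
      mul_nonneg (hw i) (hsub x hx _ (hz i)))).1 h0.symm i0 (Finset.mem_univ _)
    exact (mul_eq_zero.1 h1).resolve_left hi0.ne'
  set s := ‖q‖ with hs
  have hs0 : 0 < s := norm_pos_iff.2 hq0
  have hs1 : s ≤ 1 := by
    have := norm_sum_le Finset.univ (fun i => w i • z i)
    refine this.trans ?_
    rw [← hw1]
    refine Finset.sum_le_sum fun i _ => ?_
    rw [norm_smul, (hz i).1, mul_one, Real.norm_of_nonneg (hw i)]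
  set o := s⁻¹ • q with ho
  have hon : ‖o‖ = 1 := by
    rw [ho, norm_smul, norm_inv, ← hs, Real.norm_of_nonneg hs0.le, inv_mul_cancel₀ hs0.ne']
  have hov : ∀ v ∈ N, s ≤ ⟪o, v⟫ := by
    intro v hv
    rw [ho, real_inner_smul_left, inv_mul_eq_div, le_div_iff₀ hs0]
    have := hmin v hv
    nlinarith
  have hρ0 : 0 < Real.arcsin s := Real.arcsin_pos.2 hs0
  refine ⟨Real.arcsin s, hρ0.le, ?_, Or.inr ⟨o, hon, ?_⟩⟩
  swap
  · intro x hx hxo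
    refine bipolar K hKS hKcl o' ho' hKconv x hx fun v hv1 hvK => ?_
    have htri := InnerProductGeometry.angle_le_angle_add_angle v o x
    simp only [InnerProductGeometry.angle, hv1, hon, hx, mul_one, div_one] at htri
    have h1 : Real.arccos ⟪v, o⟫ ≤ Real.arccos s := by
      apply Real.arccos_le_arccos
      rw [real_inner_comm]; exact hov v ⟨hv1, hvK⟩
    rw [Real.arccos_eq_pi_div_two_sub_arcsin s] at h1
    exact Real.arccos_le_pi_div_two.1 (by linarith)
  rcases hs1.eq_or_lt with hs1 | hs1
  · rw [hs1, Real.arcsin_one]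
    refine (measure_mono (fun x hx => ?_)).trans ((gauss_half o').trans (le_of_eq ?_))
    · have := ho' _ hx.2
      rw [real_inner_smul_right] at this
      exact pos_of_mul_pos_right this (by positivity)
    · congr 1
      have := Real.pi_pos
      field_simp
  · set ρ := Real.arcsin s with hρ
    have hρ1 : ρ < Real.pi / 2 := Real.arcsin_lt_pi_div_two.2 hs1
    have hsin : Real.sin ρ = s := Real.sin_arcsin (by linarith) hs1.le
    set c := Real.cos ρ with hc
    have hc0 : 0 < c := Real.cos_pos_of_mem_Ioo ⟨by linarith, hρ1⟩
    have hsc : s ^ 2 + c ^ 2 = 1 := by rw [← hsin]; exact Real.sin_sq_add_cos_sq ρ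
    -- contact
    have hcontact : ∀ i, 0 < w i → ⟪o, z i⟫ = s := by
      intro i hi
      have hnn : ∀ j ∈ Finset.univ, 0 ≤ w j * (⟪o, z j⟫ - s) := fun j _ =>
        mul_nonneg (hw j) (sub_nonneg.2 (hov _ (hz j)))
      have hzero : ∑ j, w j * (⟪o, z j⟫ - s) = 0 := by
        simp_rw [mul_sub]
        rw [Finset.sum_sub_distrib, ← Finset.sum_mul, hw1, one_mul]
        have := hqx o
        rw [ho, real_inner_smul_right, real_inner_self_eq_norm_sq, ← ho, ← hs] at this
        have e : s⁻¹ * s ^ 2 = s := by field_simp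
        rw [e] at this
        rw [sub_eq_zero]
        conv_rhs => rw [this]
        exact Finset.sum_congr rfl fun j _ => by rw [real_inner_comm]
      have := (Finset.sum_eq_zero_iff_of_nonneg hnn).1 hzero i (Finset.mem_univ _)
      have := (mul_eq_zero.1 this).resolve_left hi.ne'
      linarith
    let p : {i // 0 < w i} → E := fun i => c⁻¹ • (s • o - z i)
    have : Nonempty {i // 0 < w i} := ⟨⟨i0, hi0⟩⟩
    have hoo : ⟪o, o⟫ = 1 := by rw [real_inner_self_eq_norm_sq, hon]; norm_num
    have hb := wedge_bound (fun i : {i // 0 < w i} => w i) p o hon (fun i => i.2) ?_ ?_ ?_ ρ hρ0 hρ1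
    · refine (measure_mono (fun x hx i => ?_)).trans hb
      have h1 := hsub x hx _ (hz i)
      simp only [p, real_inner_smul_left, inner_sub_left]
      rw [Real.tan_eq_sin_div_cos, hsin, ← hc, inv_mul_eq_div, div_mul_eq_mul_div]
      gcongr
      linarith
    · intro i
      have h1 : ‖s • o - z i‖ ^ 2 = c ^ 2 := by
        rw [norm_sub_sq_real, norm_smul, hon, (hz i).1, real_inner_smul_left, hcontact i i.2,
          Real.norm_of_nonneg hs0.le]
        nlinarith
      have h2 : ‖s • o - z i‖ = c := by
        exact (sq_eq_sq₀ (norm_nonneg _) hc0.le).1 h1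
      simp only [p, norm_smul, norm_inv, h2, Real.norm_of_nonneg hc0.le]
      exact inv_mul_cancel₀ hc0.ne'
    · intro i
      simp only [p, real_inner_smul_right, inner_sub_right, hoo, hcontact i i.2]
      simp
    · have hsumsub : ∀ (f : Fin k → E), (∀ i, ¬ 0 < w i → f i = 0) →
          ∑ i : {i // 0 < w i}, f i = ∑ i, f i := by
        intro f hf
        refine Fintype.sum_of_injective (fun i : {i // 0 < w i} => (i : Fin k))
          Subtype.val_injective _ _ (fun j hj => hf j fun h => hj ⟨⟨j, h⟩, rfl⟩) (fun _ => rfl)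
      have := hsumsub (fun i => w i • (c⁻¹ • (s • o - z i))) (fun i hi => by
        have : w i = 0 := le_antisymm (not_lt.1 hi) (hw i)
        simp [this])
      refine this.trans ?_
      simp_rw [smul_comm _ c⁻¹]
      rw [← Finset.smul_sum]
      simp_rw [smul_sub]
      rw [Finset.sum_sub_distrib, ← Finset.sum_smul, hw1, ← hq, ho, one_smul, smul_smul,
        mul_inv_cancel₀ hs0.ne']
      simp

end BS

theorem bezdek_schneider (n m : ℕ)
    (K : Fin m → Set (EuclideanSpace ℝ (Fin (n + 1))))
    (hKS : ∀ i, K i ⊆ {x | ‖x‖ = 1})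
    (hKcl : ∀ i, IsClosed (K i))
    (hKhemi : ∀ i, ∃ o : EuclideanSpace ℝ (Fin (n + 1)), ‖o‖ = 1 ∧
      ∀ x ∈ K i, geodist o x < Real.pi / 2)
    (hKconv : ∀ i, ∀ x ∈ K i, ∀ y ∈ K i, ∀ a b : ℝ, 0 ≤ a → 0 ≤ b →
      ‖a • x + b • y‖ = 1 → a • x + b • y ∈ K i)
    (hcover : {x : EuclideanSpace ℝ (Fin (n + 1)) | ‖x‖ = 1} ⊆ ⋃ i, K i) :
    Real.pi ≤ ∑ i, sphericalInradius (K i) := by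
  have hpi := Real.pi_pos
  set γ := ProbabilityTheory.stdGaussian (EuclideanSpace ℝ (Fin (n + 1))) with hγ
  have hnn : ∀ i, 0 ≤ sphericalInradius (K i) := fun i => Real.sSup_nonneg fun ρ hρ => hρ.1
  have hbody : ∀ i, γ {x | x ≠ 0 ∧ ‖x‖⁻¹ • x ∈ K i} ≤
      ENNReal.ofReal (sphericalInradius (K i) / Real.pi) := by
    intro i
    obtain ⟨o', ho1, ho'⟩ := hKhemi i
    have hpos : ∀ x ∈ K i, 0 < ⟪o', x⟫ := fun x hx => Real.arccos_lt_pi_div_two.1 (ho' x hx)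
    obtain ⟨ρ, hρ0, hle, hρ⟩ := BS.body (K i) (hKS i) (hKcl i) o' ho1 hpos (hKconv i)
    refine hle.trans (ENNReal.ofReal_le_ofReal ?_)
    gcongr
    rcases hρ with rfl | ⟨o, ho, hball⟩
    · exact hnn i
    · refine le_csSup ⟨Real.pi, ?_⟩ ⟨hρ0, o, ho, hball⟩
      rintro r ⟨-, u, hu, hur⟩
      by_contra hcon
      push Not at hcon
      have h1 := hpos u (hur u hu ((Real.arccos_le_pi _).trans hcon.le))
      have h2 := hpos (-u) (hur (-u) (by rwa [norm_neg]) ((Real.arccos_le_pi _).trans hcon.le))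
      rw [inner_neg_right] at h2
      linarith
  have hnull : γ {0} = 0 := by
    have h1 : ‖(EuclideanSpace.single 0 1 : EuclideanSpace ℝ (Fin (n + 1)))‖ = 1 := by simp
    refine MeasureTheory.measure_mono_null ?_ (BS.gauss_hyper _ h1)
    rintro x rfl
    exact inner_zero_right _
  have h1 : (1 : ENNReal) ≤ ∑ i, ENNReal.ofReal (sphericalInradius (K i) / Real.pi) := by
    calc (1 : ENNReal) = γ Set.univ := MeasureTheory.measure_univ.symm
      _ ≤ γ ({0} ∪ ⋃ i, {x | x ≠ 0 ∧ ‖x‖⁻¹ • x ∈ K i}) := by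
          apply MeasureTheory.measure_mono
          intro x _
          by_cases hx : x = 0
          · left; exact hx
          · right
            have hx' : ‖x‖ ≠ 0 := norm_ne_zero_iff.2 hx
            have : ‖x‖⁻¹ • x ∈ ⋃ i, K i := hcover (by
              change ‖‖x‖⁻¹ • x‖ = 1
              rw [norm_smul, norm_inv, norm_norm, inv_mul_cancel₀ hx'])
            obtain ⟨i, hi⟩ := Set.mem_iUnion.1 this
            exact Set.mem_iUnion.2 ⟨i, hx, hi⟩
      _ ≤ γ {0} + γ (⋃ i, {x | x ≠ 0 ∧ ‖x‖⁻¹ • x ∈ K i}) := MeasureTheory.measure_union_le _ _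
      _ ≤ ∑ i, γ {x | x ≠ 0 ∧ ‖x‖⁻¹ • x ∈ K i} := by
          rw [hnull, zero_add]
          exact (MeasureTheory.measure_iUnion_le _).trans (le_of_eq (tsum_fintype _))
      _ ≤ _ := Finset.sum_le_sum fun i _ => hbody i
  rw [← ENNReal.ofReal_sum_of_nonneg (fun i _ => div_nonneg (hnn i) hpi.le),
    ENNReal.one_le_ofReal, ← Finset.sum_div, le_div_iff₀ hpi, one_mul] at h1
  exact h1
end
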